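/- Let R denote the hyperfinite II₁ factor, let ω be a free ultrafilter on ℕ, and let Γ be a countable group acting on R by trace-preserving automorphisms σ. Then Γ↷^σ R is outer if and only if Γ↷^σ R is centrally free, i.e. the induced action of Γ on the central sequence algebra R' ∩ R^ω is outer. -/

import Mathlib

/-!
Common framework: we model tracial von Neumann algebras concretely, as von Neumann
algebras `M ⊆ B(H)` (Mathlib's `VonNeumannAlgebra H`, i.e. star-subalgebras equal to
their double commutant) equipped with a faithful tracial state, and we model the
crossed product `A ⋊ Γ` of a trace-preserving action axiomatically: `M` contains a
copy of `A` and a group `(u γ)` of unitaries normalizing `A`, such that the canonical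
trace-preserving conditional expectation `E_A` kills `u γ` for `γ ≠ 1`, and such that
an element of `M` all of whose Fourier coefficients `E_A (x (u γ)*)` vanish is `0`.
Probability-measure-preserving actions `Γ ↷ (X, μ)` are modelled via the associated
trace-preserving action on the abelian von Neumann algebra `A = L^∞(X)`.
-/

noncomputable section

open scoped Classical

namespace CD

/-- A group has infinite conjugacy classes (icc) if every nontrivial conjugacy
class is infinite. -/
def IsICC (Γ : Type) [Group Γ] : Prop :=
  ∀ γ : Γ, γ ≠ 1 → {g : Γ | ∃ h : Γ, g = h * γ * h⁻¹}.Infinite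

/-- A faithful tracial state on (the elements of) a set `M ⊆ B(H)` (in applications,
a von Neumann algebra), given as a globally defined linear functional whose
axioms are imposed on `M`. -/
structure TraceOn (H : Type) [NormedAddCommGroup H] [InnerProductSpace ℂ H] [CompleteSpace H]
    (M : Set (H →L[ℂ] H)) : Type where
  τ : (H →L[ℂ] H) →ₗ[ℂ] ℂ
  unital : τ 1 = 1
  tracial : ∀ x ∈ M, ∀ y ∈ M, τ (x * y) = τ (y * x)
  star_eq : ∀ x ∈ M, τ (star x) = starRingEnd ℂ (τ x)
  nonneg : ∀ x ∈ M, 0 ≤ (τ (star x * x)).re ∧ (τ (star x * x)).im = 0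
  faithful : ∀ x ∈ M, τ (star x * x) = 0 → x = 0

variable {H : Type} [NormedAddCommGroup H] [InnerProductSpace ℂ H] [CompleteSpace H]

/-- The 2-norm `‖x‖₂ = τ(x* x)^{1/2}` associated with a trace. -/
def TraceOn.norm2 {M : Set (H →L[ℂ] H)} (tr : TraceOn H M) (x : H →L[ℂ] H) : ℝ :=
  Real.sqrt (tr.τ (star x * x)).re

/-- The (unique) trace-preserving conditional expectation from `M` onto a
von Neumann subalgebra `N ⊆ M`. -/
structure CondExpOn (H : Type) [NormedAddCommGroup H] [InnerProductSpace ℂ H] [CompleteSpace H]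
    (M N : Set (H →L[ℂ] H)) (tr : TraceOn H M) : Type where
  E : (H →L[ℂ] H) →ₗ[ℂ] (H →L[ℂ] H)
  mem : ∀ x ∈ M, E x ∈ N
  fix : ∀ x ∈ N, E x = x
  bimod : ∀ a ∈ N, ∀ b ∈ N, ∀ x ∈ M, E (a * x * b) = a * E x * b
  star_map : ∀ x ∈ M, E (star x) = star (E x)
  trace_eq : ∀ x ∈ M, tr.τ (E x) = tr.τ x
  contractive : ∀ x ∈ M, tr.norm2 (E x) ≤ tr.norm2 x

/-- The double commutant of a subset of `B(H)`: the von Neumann algebra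
generated by `S` (for `S` a star-closed unital set). -/
def vnGen (S : Set (H →L[ℂ] H)) : Set (H →L[ℂ] H) :=
  Set.centralizer (Set.centralizer S)

/-- Model of the crossed product von Neumann algebra `M = A ⋊ Γ` of a
trace-preserving action `Γ ↷ (A, τ)`: `M` is generated by a copy of `A`
and canonical unitaries `(u γ)` implementing the action, with its canonical
conditional expectation `E_A` onto `A` (characterising the Fourier coefficients),
together with the group von Neumann algebra `L(Γ) = {u γ : γ}'' ⊆ M` and the
conditional expectation onto it. -/
structure CrossedProduct (Γ : Type) [Group Γ]
    (H : Type) [NormedAddCommGroup H] [InnerProductSpace ℂ H] [CompleteSpace H] : Type where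
  M : VonNeumannAlgebra H
  A : VonNeumannAlgebra H
  A_sub : (A : Set (H →L[ℂ] H)) ⊆ (M : Set (H →L[ℂ] H))
  tr : TraceOn H (M : Set (H →L[ℂ] H))
  u : Γ → (H →L[ℂ] H)
  u_mem : ∀ γ, u γ ∈ M
  u_one : u 1 = 1
  u_mul : ∀ γ δ, u γ * u δ = u (γ * δ)
  u_star : ∀ γ, star (u γ) = u γ⁻¹
  conj_mem : ∀ (γ : Γ), ∀ a ∈ A, u γ * a * star (u γ) ∈ A
  EA : CondExpOn H (M : Set (H →L[ℂ] H)) (A : Set (H →L[ℂ] H)) tr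
  EA_u : ∀ γ : Γ, γ ≠ 1 → EA.E (u γ) = 0
  fourier_sep : ∀ x ∈ M, (∀ γ : Γ, EA.E (x * star (u γ)) = 0) → x = 0
  Lg : VonNeumannAlgebra H
  Lg_eq : (Lg : Set (H →L[ℂ] H)) = vnGen (Set.range u)
  Lg_sub : (Lg : Set (H →L[ℂ] H)) ⊆ (M : Set (H →L[ℂ] H))
  EL : CondExpOn H (M : Set (H →L[ℂ] H)) (Lg : Set (H →L[ℂ] H)) tr

variable {Γ : Type} [Group Γ]

/-- The action `σ_γ = Ad(u γ)` of `Γ` on `B(H)`, restricting to the given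
action on `A`. -/
def CrossedProduct.σ (X : CrossedProduct Γ H) (γ : Γ) (x : H →L[ℂ] H) : H →L[ℂ] H :=
  X.u γ * x * star (X.u γ)

/-- The action is properly outer over the center of `P`; for abelian `P` this is
the usual freeness of the action. -/
def ProperlyOuterOn (X : CrossedProduct Γ H) (P : Set (H →L[ℂ] H)) : Prop :=
  ∀ γ : Γ, γ ≠ 1 → ∀ a ∈ P, (∀ b ∈ P, X.σ γ b * a = a * b) → a = 0

/-- Freeness of the action `Γ ↷ A`. -/
def IsFree (X : CrossedProduct Γ H) : Prop := ProperlyOuterOn X (X.A : Set (H →L[ℂ] H))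

/-- Ergodicity of the action `Γ ↷ A`: the fixed points are the scalars. -/
def IsErgodic (X : CrossedProduct Γ H) : Prop :=
  ∀ a ∈ X.A, (∀ γ : Γ, X.σ γ a = a) → ∃ c : ℂ, a = c • (1 : H →L[ℂ] H)

def IsAbelianSet (S : Set (H →L[ℂ] H)) : Prop := ∀ x ∈ S, ∀ y ∈ S, x * y = y * x

/-- `Q` is a `Γ`-invariant subset (in applications, subalgebra). -/
def InvariantUnder (X : CrossedProduct Γ H) (Q : Set (H →L[ℂ] H)) : Prop :=
  ∀ (γ : Γ), ∀ q ∈ Q, X.σ γ q ∈ Q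

/-- The intermediate crossed product `Q ⋊ Γ ⊆ A ⋊ Γ` of a (`Γ`-invariant)
subalgebra `Q ⊆ A`: those elements all of whose Fourier coefficients lie in `Q`. -/
def midCP (X : CrossedProduct Γ H) (Q : Set (H →L[ℂ] H)) : Set (H →L[ℂ] H) :=
  {x | x ∈ X.M ∧ ∀ γ : Γ, X.EA.E (x * star (X.u γ)) ∈ Q}

/-- The intermediate crossed product `A ⋊ K ⊆ A ⋊ Γ` of a subgroup `K ≤ Γ`:
those elements whose Fourier coefficients are supported on `K`. -/
def subgpCP (X : CrossedProduct Γ H) (K : Subgroup Γ) : Set (H →L[ℂ] H) :=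
  {x | x ∈ X.M ∧ ∀ γ : Γ, γ ∉ K → X.EA.E (x * star (X.u γ)) = 0}

/-- The quasinormalizer `QN_M(P)` of `P` inside `M`. -/
def QNset (M P : Set (H →L[ℂ] H)) : Set (H →L[ℂ] H) :=
  {x | x ∈ M ∧ ∃ (n : ℕ) (y : Fin n → (H →L[ℂ] H)), (∀ i, y i ∈ M) ∧
    (∀ p ∈ P, ∃ q : Fin n → (H →L[ℂ] H), (∀ i, q i ∈ P) ∧ p * x = ∑ i, y i * q i) ∧
    (∀ p ∈ P, ∃ q : Fin n → (H →L[ℂ] H), (∀ i, q i ∈ P) ∧ x * p = ∑ i, q i * y i)}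

def IsUnitaryIn (S : Set (H →L[ℂ] H)) (x : H →L[ℂ] H) : Prop :=
  x ∈ S ∧ star x * x = 1 ∧ x * star x = 1

def IsProjIn (S : Set (H →L[ℂ] H)) (p : H →L[ℂ] H) : Prop :=
  p ∈ S ∧ star p = p ∧ p * p = p

/-- The relative commutant `N' ∩ S`. -/
def commutantIn (N S : Set (H →L[ℂ] H)) : Set (H →L[ℂ] H) :=
  {x | x ∈ S ∧ ∀ y ∈ N, x * y = y * x}

/-- Conjugation `w ( · ) w*` applied to a set. -/
def conjSet (w : H →L[ℂ] H) (S : Set (H →L[ℂ] H)) : Set (H →L[ℂ] H) :=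
  (fun y => w * y * star w) '' S

/-- The scalars `ℂ 1 ⊆ B(H)`. -/
def scalars (H : Type) [NormedAddCommGroup H] [InnerProductSpace ℂ H] [CompleteSpace H] :
    Set (H →L[ℂ] H) :=
  Set.range (fun c : ℂ => c • (1 : H →L[ℂ] H))

/-- The extension `P₀ ⊆ P` of `Γ`-algebras is compact: there is a family `F ⊆ P`
with dense `‖·‖₂`-span in `P` such that the `Γ`-orbit of each `f ∈ F` can be
uniformly approximated by finitely many "`P₀`-finite rank modules". -/
def IsCompactExt (X : CrossedProduct Γ H) (P₀ P : Set (H →L[ℂ] H)) : Prop :=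
  ∃ F : Set (H →L[ℂ] H), F ⊆ P ∧
    (∀ p ∈ P, ∀ ε : ℝ, 0 < ε → ∃ (n : ℕ) (c : Fin n → ℂ) (f : Fin n → (H →L[ℂ] H)),
      (∀ i, f i ∈ F) ∧ X.tr.norm2 (p - ∑ i, c i • f i) ≤ ε) ∧
    (∀ f ∈ F, ∀ ε : ℝ, 0 < ε → ∃ (n : ℕ) (ξ : Fin n → (H →L[ℂ] H)) (C : ℝ),
      (∀ i, ξ i ∈ P) ∧
      ∀ γ : Γ, ∃ κ : Fin n → (H →L[ℂ] H), (∀ i, κ i ∈ P₀) ∧ (∀ i, ‖κ i‖ ≤ C) ∧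
        X.tr.norm2 (X.σ γ f - ∑ i, κ i * ξ i) ≤ ε)

/-- The action `Γ ↷ A` is compact: the extension over the scalars is compact. -/
def IsCompactAction (X : CrossedProduct Γ H) : Prop :=
  IsCompactExt X (scalars H) (X.A : Set (H →L[ℂ] H))

/-- The `Γ`-invariant subalgebra `B ⊆ A` gives a mixing extension: for
`t, z ∈ A ⊖ B` one has `‖E_B(t σ_γ(z))‖₂ → 0` as `γ → ∞`. -/
def IsMixingExt (X : CrossedProduct Γ H) (B : Set (H →L[ℂ] H))
    (EB : CondExpOn H (X.M : Set (H →L[ℂ] H)) B X.tr) : Prop :=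
  ∀ t ∈ X.A, ∀ z ∈ X.A, EB.E t = 0 → EB.E z = 0 →
    Filter.Tendsto (fun γ : Γ => X.tr.norm2 (EB.E (t * X.σ γ z))) Filter.cofinite (nhds 0)

/-- A `*`-isomorphism from (the von Neumann algebra with underlying set) `M ⊆ B(H₁)`
onto `N ⊆ B(H₂)`, given as a globally defined map with all axioms imposed on `M`. -/
structure StarIsoOn {H₁ : Type} [NormedAddCommGroup H₁] [InnerProductSpace ℂ H₁]
    [CompleteSpace H₁] {H₂ : Type} [NormedAddCommGroup H₂] [InnerProductSpace ℂ H₂]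
    [CompleteSpace H₂] (M : Set (H₁ →L[ℂ] H₁)) (N : Set (H₂ →L[ℂ] H₂)) : Type where
  Θ : (H₁ →L[ℂ] H₁) → (H₂ →L[ℂ] H₂)
  mem : ∀ x ∈ M, Θ x ∈ N
  map_one : Θ 1 = 1
  map_add : ∀ x ∈ M, ∀ y ∈ M, Θ (x + y) = Θ x + Θ y
  map_smul : ∀ (c : ℂ), ∀ x ∈ M, Θ (c • x) = c • Θ x
  map_mul : ∀ x ∈ M, ∀ y ∈ M, Θ (x * y) = Θ x * Θ y
  map_star : ∀ x ∈ M, Θ (star x) = star (Θ x)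
  inj : ∀ x ∈ M, ∀ y ∈ M, Θ x = Θ y → x = y
  surj : ∀ y ∈ N, ∃ x ∈ M, Θ x = y

/-- `r` is the (Pimsner–Popa/Jones) index of the inclusion `N ⊆ M`, witnessed by a
finite Pimsner–Popa basis `m₁, …, m_k` with `E_N (m_i m_j*) = δ_{ij} p_i`,
`x = ∑ᵢ E_N(x mᵢ*) mᵢ` for `x ∈ M`, and `r = ∑ᵢ τ(pᵢ)`. -/
def HasPPIndex {Mamb : Set (H →L[ℂ] H)} (tr : TraceOn H Mamb)
    (M N : Set (H →L[ℂ] H)) (r : ℝ) : Prop :=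
  ∃ E : (H →L[ℂ] H) →ₗ[ℂ] (H →L[ℂ] H),
    (∀ x ∈ M, E x ∈ N) ∧ (∀ x ∈ N, E x = x) ∧
    (∀ a ∈ N, ∀ b ∈ N, ∀ x ∈ M, E (a * x * b) = a * E x * b) ∧
    (∀ x ∈ M, tr.τ (E x) = tr.τ x) ∧
    ∃ (k : ℕ) (m p : Fin k → (H →L[ℂ] H)),
      (∀ i, m i ∈ M) ∧ (∀ i, p i ∈ N ∧ star (p i) = p i ∧ p i * p i = p i) ∧
      (∀ i j, E (m i * star (m j)) = if i = j then p i else 0) ∧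
      (∀ x ∈ M, x = ∑ i, E (x * star (m i)) * m i) ∧
      r = (∑ i, tr.τ (p i)).re

/-- The inclusion `N ⊆ M` has finite (Pimsner–Popa/Jones) index. -/
def FiniteIndexIn {Mamb : Set (H →L[ℂ] H)} (tr : TraceOn H Mamb)
    (M N : Set (H →L[ℂ] H)) : Prop :=
  ∃ r : ℝ, HasPPIndex tr M N r

/-- `S` (a von Neumann algebra) is a factor: trivial center. -/
def IsFactorSet (S : Set (H →L[ℂ] H)) : Prop :=
  ∀ x ∈ S, (∀ y ∈ S, x * y = y * x) → ∃ c : ℂ, x = c • (1 : H →L[ℂ] H)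

/-- `S` is a II₁ factor (with respect to the trace `tr`): a factor whose
projections realize every trace value in `[0,1]`. -/
def IsII1On {Mamb : Set (H →L[ℂ] H)} (tr : TraceOn H Mamb) (S : Set (H →L[ℂ] H)) : Prop :=
  IsFactorSet S ∧ ∀ r : ℝ, 0 ≤ r → r ≤ 1 →
    ∃ p ∈ S, star p = p ∧ p * p = p ∧ tr.τ p = (r : ℂ)

def IsFinDimSet (S : Set (H →L[ℂ] H)) : Prop :=
  ∃ (n : ℕ) (v : Fin n → (H →L[ℂ] H)), (∀ i, v i ∈ S) ∧
    ∀ x ∈ S, ∃ c : Fin n → ℂ, x = ∑ i, c i • v i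

def IsStarSubalgSet (S : Set (H →L[ℂ] H)) : Prop :=
  (1 : H →L[ℂ] H) ∈ S ∧ (∀ x ∈ S, ∀ y ∈ S, x + y ∈ S) ∧ (∀ x ∈ S, ∀ y ∈ S, x * y ∈ S) ∧
    (∀ (c : ℂ), ∀ x ∈ S, c • x ∈ S) ∧ (∀ x ∈ S, star x ∈ S)

/-- `S` is approximately finite dimensional (with respect to `‖·‖₂`); by Connes'
theorem this is equivalent to amenability for (separable, tracial) von Neumann
algebras. -/
def IsAFD {Mamb : Set (H →L[ℂ] H)} (tr : TraceOn H Mamb) (S : Set (H →L[ℂ] H)) : Prop :=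
  ∃ Q : ℕ → Set (H →L[ℂ] H), (∀ n, Q n ⊆ S) ∧ (∀ n, Q n ⊆ Q (n + 1)) ∧
    (∀ n, IsFinDimSet (Q n)) ∧ (∀ n, IsStarSubalgSet (Q n)) ∧
    ∀ x ∈ S, ∀ ε : ℝ, 0 < ε → ∃ n, ∃ y ∈ Q n, tr.norm2 (x - y) ≤ ε

/-- `S` is diffuse: it has no minimal projections. -/
def IsDiffuseSet (S : Set (H →L[ℂ] H)) : Prop :=
  ∀ p, IsProjIn S p → p ≠ 0 →
    ∃ q, IsProjIn S q ∧ q ≠ 0 ∧ q ≠ p ∧ q * p = q ∧ p * q = q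

/-- The (trace-preserving) action of `Γ` on the subalgebra `Q` is transitive:
`Q` is spanned by finitely many orthogonal minimal projections summing to `1`
which are permuted transitively by `Γ`. -/
def IsTransitiveOn (X : CrossedProduct Γ H) (Q : Set (H →L[ℂ] H)) : Prop :=
  ∃ (n : ℕ) (e : Fin n → (H →L[ℂ] H)),
    (∀ i, e i ∈ Q ∧ star (e i) = e i ∧ e i * e i = e i) ∧
    (∀ i j, i ≠ j → e i * e j = 0) ∧ (∑ i, e i = 1) ∧
    (∀ q ∈ Q, ∃ c : Fin n → ℂ, q = ∑ i, c i • e i) ∧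
    (∀ i j, ∃ γ : Γ, X.σ γ (e i) = e j)

/-- An abelian von Neumann algebra `S` is completely atomic: every nonzero
projection dominates a minimal projection. -/
def IsCompletelyAtomic (S : Set (H →L[ℂ] H)) : Prop :=
  ∀ p, IsProjIn S p → p ≠ 0 →
    ∃ q, IsProjIn S q ∧ q ≠ 0 ∧ q * p = q ∧
      ∀ r, IsProjIn S r → r * q = r → r = 0 ∨ r = q

end CD

namespace CD

variable {H : Type} [NormedAddCommGroup H] [InnerProductSpace ℂ H] [CompleteSpace H]

/-- A trace-preserving action of `Γ` on (the von Neumann algebra with underlying set)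
`R`, by `*`-automorphisms. -/
structure ActionOn (Γ : Type) [Group Γ] (H : Type) [NormedAddCommGroup H]
    [InnerProductSpace ℂ H] [CompleteSpace H] (R : Set (H →L[ℂ] H))
    (tr : TraceOn H R) : Type where
  α : Γ → (H →L[ℂ] H) → (H →L[ℂ] H)
  mem : ∀ γ : Γ, ∀ x ∈ R, α γ x ∈ R
  one : ∀ x ∈ R, α 1 x = x
  mul : ∀ γ δ : Γ, ∀ x ∈ R, α (γ * δ) x = α γ (α δ x)
  add : ∀ γ : Γ, ∀ x ∈ R, ∀ y ∈ R, α γ (x + y) = α γ x + α γ y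
  smulc : ∀ (γ : Γ) (c : ℂ), ∀ x ∈ R, α γ (c • x) = c • α γ x
  mulm : ∀ γ : Γ, ∀ x ∈ R, ∀ y ∈ R, α γ (x * y) = α γ x * α γ y
  star_map : ∀ γ : Γ, ∀ x ∈ R, α γ (star x) = star (α γ x)
  trace_eq : ∀ γ : Γ, ∀ x ∈ R, tr.τ (α γ x) = tr.τ x
  surj : ∀ γ : Γ, ∀ y ∈ R, ∃ x ∈ R, α γ x = y

/-- The action is outer: no `α_γ`, `γ ≠ 1`, is inner. -/
def ActionOn.IsOuter {Γ : Type} [Group Γ] {R : Set (H →L[ℂ] H)} {tr : TraceOn H R}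
    (act : ActionOn Γ H R tr) : Prop :=
  ∀ γ : Γ, γ ≠ 1 → ¬ ∃ w, IsUnitaryIn R w ∧ ∀ x ∈ R, act.α γ x = w * x * star w

/-- An `ω`-central sequence of `R`: a bounded sequence in `R` asymptotically
commuting (in `‖·‖₂`, along `ω`) with every element of `R`.  These represent the
elements of the central sequence algebra `R' ∩ R^ω`. -/
def IsCentralSeq (R : Set (H →L[ℂ] H)) (tr : TraceOn H R) (ω : Ultrafilter ℕ)
    (x : ℕ → (H →L[ℂ] H)) : Prop :=
  (∀ n, x n ∈ R) ∧ (∃ C : ℝ, ∀ n, ‖x n‖ ≤ C) ∧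
  ∀ r ∈ R, Filter.Tendsto (fun n => tr.norm2 (x n * r - r * x n)) (ω : Filter ℕ) (nhds 0)

/-- Equality in the tracial ultrapower `R^ω`. -/
def UltraEq {R : Set (H →L[ℂ] H)} (tr : TraceOn H R) (ω : Ultrafilter ℕ)
    (x y : ℕ → (H →L[ℂ] H)) : Prop :=
  Filter.Tendsto (fun n => tr.norm2 (x n - y n)) (ω : Filter ℕ) (nhds 0)

/-- The action is centrally free: the induced action of `Γ` on the central sequence
algebra `R' ∩ R^ω` is outer. -/
def ActionOn.IsCentrallyFree {Γ : Type} [Group Γ] {R : Set (H →L[ℂ] H)}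
    {tr : TraceOn H R} (act : ActionOn Γ H R tr) (ω : Ultrafilter ℕ) : Prop :=
  ∀ γ : Γ, γ ≠ 1 → ¬ ∃ u : ℕ → (H →L[ℂ] H),
    IsCentralSeq R tr ω u ∧ (∀ n, IsUnitaryIn R (u n)) ∧
    ∀ x : ℕ → (H →L[ℂ] H), IsCentralSeq R tr ω x →
      UltraEq tr ω (fun n => act.α γ (x n)) (fun n => u n * x n * star (u n))

end CD

noncomputable section
open scoped Classical ComplexOrder InnerProductSpace
namespace CDP

/-- A trace on a C*-algebra together with a GNS type vector map. -/
structure TrRep (A K : Type) [CStarAlgebra A] [NormedAddCommGroup K] [InnerProductSpace ℂ K] where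
  Λ : A →ₗ[ℂ] K
  t : A →ₗ[ℂ] ℂ
  inner_eq : ∀ x y, inner ℂ (Λ x) (Λ y) = t (star x * y)
  tr : ∀ x y, t (x * y) = t (y * x)

section basic
variable {A K : Type} [CStarAlgebra A] [PartialOrder A] [StarOrderedRing A]
  [NormedAddCommGroup K] [InnerProductSpace ℂ K] (S : TrRep A K)

lemma TrRep.norm_sq (x : A) : ‖S.Λ x‖ ^ 2 = (S.t (star x * x)).re := by
  rw [← S.inner_eq, inner_self_eq_norm_sq_to_K]
  norm_cast

lemma TrRep.t_nonneg {x : A} (hx : 0 ≤ x) : 0 ≤ (S.t x).re := by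
  obtain ⟨s, rfl⟩ := CStarAlgebra.nonneg_iff_eq_star_mul_self.mp hx
  rw [← S.norm_sq]; positivity

lemma TrRep.t_mono {x y : A} (h : x ≤ y) : (S.t x).re ≤ (S.t y).re := by
  have := S.t_nonneg (sub_nonneg.mpr h)
  rw [map_sub, Complex.sub_re] at this
  linarith

lemma TrRep.norm_star (x : A) : ‖S.Λ (star x)‖ = ‖S.Λ x‖ := by
  have : ‖S.Λ (star x)‖ ^ 2 = ‖S.Λ x‖ ^ 2 := by
    rw [S.norm_sq, S.norm_sq, star_star, S.tr]
  exact (sq_eq_sq₀ (norm_nonneg _) (norm_nonneg _)).mp this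

lemma TrRep.norm_mul_left (x y : A) : ‖S.Λ (x * y)‖ ≤ ‖x‖ * ‖S.Λ y‖ := by
  refine abs_le_of_sq_le_sq' ?_ (by positivity) |>.2
  rw [mul_pow, S.norm_sq, S.norm_sq]
  have h1 : star x * x ≤ algebraMap ℝ A (‖x‖ ^ 2) := CStarAlgebra.star_mul_le_algebraMap_norm_sq
  have h2 := star_left_conjugate_le_conjugate h1 y
  have h3 := S.t_mono h2
  have e1 : star (x * y) * (x * y) = star y * (star x * x) * y := by
    simp [mul_assoc]
  have e2 : star y * algebraMap ℝ A (‖x‖ ^ 2) * y = ((‖x‖ ^ 2 : ℝ) : ℂ) • (star y * y) := by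
    rw [Algebra.algebraMap_eq_smul_one, Complex.coe_smul]
    simp
  rw [e1]
  rw [e2, map_smul, smul_eq_mul, Complex.re_ofReal_mul] at h3
  exact h3

lemma TrRep.norm_mul_right (x y : A) : ‖S.Λ (x * y)‖ ≤ ‖S.Λ x‖ * ‖y‖ := by
  rw [← S.norm_star, star_mul, mul_comm]
  refine (S.norm_mul_left _ _).trans ?_
  rw [S.norm_star, _root_.norm_star]

lemma TrRep.norm_unitary_left {u : A} (hu : u ∈ unitary A) (x : A) :
    ‖S.Λ (u * x)‖ = ‖S.Λ x‖ := by
  have : ‖S.Λ (u * x)‖ ^ 2 = ‖S.Λ x‖ ^ 2 := by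
    rw [S.norm_sq, S.norm_sq, star_mul, mul_assoc, ← mul_assoc (star u), Unitary.star_mul_self_of_mem hu, one_mul]
  exact (sq_eq_sq₀ (norm_nonneg _) (norm_nonneg _)).mp this

lemma TrRep.norm_unitary_right {u : A} (hu : u ∈ unitary A) (x : A) :
    ‖S.Λ (x * u)‖ = ‖S.Λ x‖ := by
  rw [← S.norm_star, star_mul, S.norm_unitary_left (Unitary.star_mem hu), S.norm_star]

lemma TrRep.t_eq (x : A) : S.t x = inner ℂ (S.Λ 1) (S.Λ x) := by
  rw [S.inner_eq]; simp

lemma TrRep.norm_le (x : A) : ‖S.Λ x‖ ≤ ‖x‖ * ‖S.Λ 1‖ := by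
  simpa using S.norm_mul_left x 1

lemma TrRep.t_star_mul_le (x y : A) : ‖S.t (star x * y)‖ ≤ ‖S.Λ x‖ * ‖S.Λ y‖ := by
  rw [← S.inner_eq]; exact norm_inner_le_norm _ _

lemma TrRep.t_mul_nonneg {x y : A} (hx : 0 ≤ x) (hy : 0 ≤ y) : 0 ≤ (S.t (x * y)).re := by
  obtain ⟨s, rfl⟩ := CStarAlgebra.nonneg_iff_eq_star_mul_self.mp hx
  rw [mul_assoc, S.tr]
  exact S.t_nonneg (star_right_conjugate_nonneg hy s)

end basic

/-- Unitaries detect commutation-like linear identities. -/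
lemma of_unitary {A V : Type} [CStarAlgebra A] [AddCommGroup V] [Module ℂ V]
    (f g : A →ₗ[ℂ] V) (h : ∀ u ∈ unitary A, f u = g u) : f = g := by
  refine LinearMap.ext_on (CStarAlgebra.span_unitary A) ?_
  intro u hu
  exact h u hu

/-- minimal norm element. -/
lemma exists_min {K : Type} [NormedAddCommGroup K] [InnerProductSpace ℂ K] [CompleteSpace K]
    (D : Set K) (hne : D.Nonempty) (hc : Convex ℝ D) :
    ∃ κ ∈ closure D, ∀ U : K →L[ℂ] K, (∀ x, ‖U x‖ = ‖x‖) → (∀ d ∈ D, U d ∈ D) → U κ = κ := by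
  let _ := InnerProductSpace.complexToReal (G := K)
  obtain ⟨κ, hκ, hmin⟩ := exists_norm_eq_iInf_of_complete_convex (K := closure D) hne.closure
    isClosed_closure.isComplete hc.closure 0
  refine ⟨κ, hκ, fun U hU hD => ?_⟩
  have hUκ : U κ ∈ closure D := by
    have : Set.MapsTo U (closure D) (closure D) :=
      Set.MapsTo.closure (fun d hd => hD d hd) U.continuous
    exact this hκ
  have h1 := (norm_eq_iInf_iff_real_inner_le_zero hc.closure hκ).mp hmin (U κ) hUκ
  have h2 : ‖U κ - κ‖ ^ 2 ≤ 0 := by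
    have e := norm_sub_sq_real (U κ) κ
    have h3 : inner ℝ (0 - κ) (U κ - κ) = ‖κ‖ ^ 2 - inner ℝ (U κ) κ := by
      rw [zero_sub, inner_neg_left, inner_sub_right, real_inner_self_eq_norm_sq, real_inner_comm]
      ring
    rw [h3] at h1
    rw [e, hU]; linarith
  have h4 : ‖U κ - κ‖ = 0 := by nlinarith [norm_nonneg (U κ - κ)]
  exact sub_eq_zero.mp (norm_eq_zero.mp h4)

end CDP

end

noncomputable section
open scoped Classical ComplexOrder InnerProductSpace
open Filter Topology
namespace CDP

/-- Abstract properties of a factor represented on a Hilbert space. -/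
structure VN (A H : Type) [CStarAlgebra A] [PartialOrder A] [StarOrderedRing A]
    [NormedAddCommGroup H] [InnerProductSpace ℂ H] [CompleteSpace H] where
  π : A →⋆ₐ[ℂ] (H →L[ℂ] H)
  norm_π : ∀ x, ‖π x‖ = ‖x‖
  nonneg : ∀ x, (∀ ξ, 0 ≤ inner ℂ ξ (π x ξ)) → 0 ≤ x
  wot : ∀ (x : ℕ → A) (C : ℝ), (∀ n, ‖x n‖ ≤ C) → ∃ y : A, ‖y‖ ≤ C ∧ ∀ ξ η : H,
    Tendsto (fun n => inner ℂ ξ (π (x n) η)) (hyperfilter ℕ) (𝓝 (inner ℂ ξ (π y η)))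
  factor : ∀ x, (∀ y, x * y = y * x) → ∃ c : ℂ, x = c • (1 : A)
  ideal : ∀ j : A, j ≠ 0 → ∀ ξ : H,
    ξ ∈ closure (Submodule.span ℂ {η : H | ∃ a ζ, η = π (a * j) ζ} : Set H)

section B
variable {A K H : Type} [CStarAlgebra A] [PartialOrder A] [StarOrderedRing A]
  [NormedAddCommGroup K] [InnerProductSpace ℂ K]
  [NormedAddCommGroup H] [InnerProductSpace ℂ H] [CompleteSpace H]
  (S : TrRep A K) (V : VN A H)

lemma VN.inner_nonneg {x : A} (hx : 0 ≤ x) (ξ : H) : 0 ≤ inner ℂ ξ (V.π x ξ) := by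
  obtain ⟨s, rfl⟩ := CStarAlgebra.nonneg_iff_eq_star_mul_self.mp hx
  rw [map_mul, map_star]
  have : inner ℂ ξ ((star (V.π s) * V.π s) ξ) = inner ℂ (V.π s ξ) (V.π s ξ) := by
    rw [ContinuousLinearMap.mul_apply, ContinuousLinearMap.star_eq_adjoint,
      ContinuousLinearMap.adjoint_inner_right]
  rw [this, inner_self_eq_norm_sq_to_K]
  norm_cast; positivity

lemma VN.inner_mono {x y : A} (h : x ≤ y) (ξ : H) :
    (inner ℂ ξ (V.π x ξ)).re ≤ (inner ℂ ξ (V.π y ξ)).re := by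
  have := V.inner_nonneg (sub_nonneg.mpr h) ξ
  rw [map_sub, ContinuousLinearMap.sub_apply, inner_sub_right] at this
  have := (Complex.le_def.mp this).1
  simp at this
  linarith

lemma inv_exists (T : A) (h : 1 ≤ T) : ∃ r : A, 0 ≤ r ∧ r ≤ 1 ∧ r * T = 1 ∧ T * r = 1 := by
  have hu : IsUnit T := CStarAlgebra.isUnit_of_le 1 h
  obtain ⟨u, rfl⟩ := hu
  refine ⟨↑u⁻¹, ?_, ?_, by simp, by simp⟩
  · have h0 : (0 : A) ≤ u := le_trans zero_le_one h
    have := star_left_conjugate_nonneg h0 (↑u⁻¹ : A)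
    have hs : star (↑u⁻¹ : A) = ↑u⁻¹ := by
      have h1 : star (u : A) = u := (IsSelfAdjoint.of_nonneg h0)
      have h2 : star u = u := Units.ext (by simpa using h1)
      have h3 : star (u⁻¹) = u⁻¹ := by rw [star_inv, h2]
      have := congrArg (Units.val) h3
      simpa using this
    rw [hs] at this
    simpa using this
  · have := CStarAlgebra.inv_le_inv (a := (1 : Aˣ)) (b := u) (by simp) (by simpa using h)
    simpa using this

lemma inv_anti {T T' r r' : A} (h : 1 ≤ T) (h' : T ≤ T') (hr : r * T = 1) (hr2 : T * r = 1)
    (hr' : r' * T' = 1) (hr2' : T' * r' = 1) : r' ≤ r := by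
  let u : Aˣ := ⟨T, r, hr2, hr⟩
  let u' : Aˣ := ⟨T', r', hr2', hr'⟩
  exact CStarAlgebra.inv_le_inv (a := u) (b := u') (le_trans zero_le_one h) h'


end B
end CDP

end

noncomputable section
open scoped Classical ComplexOrder InnerProductSpace
open Filter Topology
namespace CDP
section C
variable {A K H : Type} [CStarAlgebra A] [PartialOrder A] [StarOrderedRing A]
  [NormedAddCommGroup K] [InnerProductSpace ℂ K]
  [NormedAddCommGroup H] [InnerProductSpace ℂ H] [CompleteSpace H]
  (S : TrRep A K) (V : VN A H)

lemma VN.inner_star_mul (x : A) (ξ : H) :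
    inner ℂ ξ (V.π (star x * x) ξ) = ((‖V.π x ξ‖ ^ 2 : ℝ) : ℂ) := by
  rw [map_mul, map_star, mul_apply_eq_comp, ContinuousLinearMap.star_eq_adjoint,
      ContinuousLinearMap.adjoint_inner_right, inner_self_eq_norm_sq_to_K]
  norm_cast

lemma sing_step (h1 : ‖S.Λ 1‖ = 1) (x : A) (ξ : H) (L δ : ℝ) (hL : 1 ≤ L)
    (hx : ‖S.Λ (x - 1)‖ ≤ δ) (hξ : ‖V.π x ξ‖ ≤ δ) :
    ∃ a : A, 0 ≤ a ∧ a ≤ 1 ∧ (inner ℂ ξ (V.π a ξ)).re ≤ L ^ 2 * δ ^ 2 ∧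
      (S.t (1 - a)).re ≤ 1 / L + δ := by
  set y : A := ((L : ℝ) ^ 2) • (star x * x) with hy
  have hL0 : 0 < L := by linarith
  have hy0 : 0 ≤ y := smul_nonneg (by positivity) (star_mul_self_nonneg x)
  obtain ⟨r, hr0, hr1, hrT, hTr⟩ := inv_exists (1 + y) (by simpa using hy0)
  have e1 : r + r * y = 1 := by rw [← hrT]; noncomm_ring
  have e2 : r + y * r = 1 := by rw [← hTr]; noncomm_ring
  have ea : 1 - r = r * y := by rw [← e1]; noncomm_ring
  have ea2 : 1 - r = y * r := by rw [← e2]; noncomm_ring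
  have hrs : star r = r := IsSelfAdjoint.of_nonneg hr0
  have hys : star y = y := IsSelfAdjoint.of_nonneg hy0
  have hrn : ‖r‖ ≤ 1 := (CStarAlgebra.norm_le_one_iff_of_nonneg r hr0).mpr hr1
  have han : ‖1 - r‖ ≤ 1 := (CStarAlgebra.norm_le_one_iff_of_nonneg (1-r) (sub_nonneg.mpr hr1)).mpr (by simpa using hr0)
  refine ⟨1 - r, sub_nonneg.mpr hr1, by simpa using hr0, ?_, ?_⟩
  · have hle : 1 - r ≤ y := by
      have h : 0 ≤ star y * r * y := star_left_conjugate_nonneg hr0 y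
      have : star y * r * y = y - (1 - r) := by
        rw [hys, mul_assoc, ← ea, mul_sub, ← ea2, mul_one]
      rw [this] at h
      exact sub_nonneg.mp h
    refine (V.inner_mono hle ξ).trans ?_
    have : V.π y = ((L^2 : ℝ) : ℂ) • V.π (star x * x) := by
      rw [hy, ← map_smul, Complex.coe_smul]
    rw [this, smul_apply, inner_smul_right, V.inner_star_mul]
    rw [← Complex.ofReal_mul, Complex.ofReal_re]
    gcongr
  · rw [sub_sub_cancel]
    have d : S.t r = S.t (star r * (1 - x)) + S.t (star (1:A) * (x * r)) := by
      rw [hrs, star_one, one_mul, S.tr x r, ← map_add]; congr 1; noncomm_ring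
    have b1 : ‖S.t (star r * (1 - x))‖ ≤ δ := by
      refine (S.t_star_mul_le _ _).trans ?_
      have : ‖S.Λ r‖ ≤ 1 := by
        refine (S.norm_le r).trans ?_
        rw [h1]; linarith
      have h2 : ‖S.Λ (1 - x)‖ ≤ δ := by rw [← neg_sub, map_neg, norm_neg]; exact hx
      nlinarith [norm_nonneg (S.Λ r), norm_nonneg (S.Λ (1-x))]
    have b2 : ‖S.t (star (1:A) * (x * r))‖ ≤ 1 / L := by
      refine (S.t_star_mul_le _ _).trans ?_
      rw [h1, one_mul]
      refine (S.norm_le _).trans ?_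
      rw [h1, mul_one]
      have : ‖x * r‖ ^ 2 ≤ (1 / L) ^ 2 := by
        rw [sq, ← CStarRing.norm_star_mul_self]
        have e : star (x * r) * (x * r) = ((1 / L) ^ 2 : ℝ) • ((1 - r) * r) := by
          rw [ea, hy, star_mul, hrs]
          simp only [mul_smul_comm, smul_mul_assoc, smul_smul]
          have : (1 / L) ^ 2 * L ^ 2 = 1 := by field_simp
          rw [this, one_smul]; noncomm_ring
        rw [e, norm_smul, Real.norm_of_nonneg (by positivity)]
        have : ‖(1 - r) * r‖ ≤ 1 := (norm_mul_le _ _).trans (by nlinarith [norm_nonneg r, norm_nonneg (1-r)])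
        have h0 : 0 ≤ (1/L)^2 := by positivity
        nlinarith
      exact abs_le_of_sq_le_sq' this (by positivity) |>.2
    have := Complex.re_le_norm (S.t r)
    have t := norm_add_le (S.t (star r * (1 - x))) (S.t (star (1:A) * (x * r)))
    rw [← d] at t
    linarith

lemma sing_excl (h1 : ‖S.Λ 1‖ = 1) (hf : ∀ x, S.Λ x = 0 → x = 0) (ξ : H) (hξ : ‖ξ‖ = 1) :
    ∃ δ > 0, ∀ x : A, ‖S.Λ (x - 1)‖ ≤ δ → ‖V.π x ξ‖ ≤ δ → False := by
  by_contra hcon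
  push Not at hcon
  have h2 : ∀ k : ℕ, ∃ a : A, 0 ≤ a ∧ a ≤ 1 ∧ (inner ℂ ξ (V.π a ξ)).re ≤ (1/4)^(k+1) ∧
      (S.t (1 - a)).re ≤ (1/2)^k := by
    intro k
    set L : ℝ := 2^(k+1)
    have hL : 1 ≤ L := one_le_pow₀ (by norm_num)
    set δ : ℝ := (1/4)^(k+1)
    have hLδ : L ^ 2 * δ = 1 := by
      simp only [L, δ]; rw [← pow_mul, mul_comm (k+1) 2, pow_mul, ← mul_pow]; norm_num
    have hδ : 0 < δ := by positivity
    have hδ1 : δ ≤ 1 := by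
      have := one_le_pow₀ hL (n := 2); nlinarith
    obtain ⟨x, hx, hx2, -⟩ := hcon δ hδ
    obtain ⟨a, h0, h1, h2, h3⟩ := sing_step S V h1 x ξ L δ hL hx hx2
    refine ⟨a, h0, h1, h2.trans ?_, h3.trans ?_⟩
    · rw [sq δ, ← mul_assoc, hLδ, one_mul]
    · have e1 : 1 / L = (1/2)^(k+1) := by simp [L]
      have e2 : δ ≤ (1/2)^(k+1) := pow_le_pow_left₀ (by norm_num) (by norm_num) _
      rw [e1]
      have : (1/2:ℝ)^k = (1/2)^(k+1) + (1/2)^(k+1) := by ring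
      linarith
  choose a ha0 ha1 haξ hat using h2
  let T : ℕ → A := fun m => 1 + ∑ k ∈ Finset.range m, (2^k : ℝ) • a k
  have hterm : ∀ k, 0 ≤ (2^k : ℝ) • a k := fun k => smul_nonneg (by positivity) (ha0 k)
  have hT1 : ∀ m, 1 ≤ T m := fun m => by
    simpa [T] using Finset.sum_nonneg (fun k _ => hterm k)
  have hTmono : Monotone T := by
    refine monotone_nat_of_le_succ fun m => ?_
    simp only [T, Finset.sum_range_succ, ← add_assoc]
    simpa using hterm m
  choose b hb0 hb1 hbT hTb using fun m => inv_exists (T m) (hT1 m)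
  have hanti : Antitone b := fun m n hmn =>
    inv_anti (hT1 m) (hTmono hmn) (hbT m) (hTb m) (hbT n) (hTb n)
  have hbn : ∀ m, ‖b m‖ ≤ 1 := fun m => (CStarAlgebra.norm_le_one_iff_of_nonneg _ (hb0 m)).mpr (hb1 m)
  obtain ⟨c, -, hc⟩ := V.wot b 1 hbn
  -- lower bound on phi
  have hTξ : ∀ m, (inner ℂ ξ (V.π (T m) ξ)).re ≤ 2 := by
    intro m
    have e : (inner ℂ ξ (V.π (T m) ξ)).re = 1 + ∑ k ∈ Finset.range m, 2^k * (inner ℂ ξ (V.π (a k) ξ)).re := by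
      simp only [T, map_add, map_one, map_sum, add_apply, one_apply_eq_self, inner_add_right, sum_apply, inner_sum,
        Complex.add_re, Complex.re_sum]
      congr 1
      · rw [inner_self_eq_norm_sq_to_K, hξ]; simp
      · refine Finset.sum_congr rfl fun k _ => ?_
        have : V.π ((2^k : ℝ) • a k) = ((2^k : ℝ) : ℂ) • V.π (a k) := by
          rw [← map_smul, Complex.coe_smul]
        rw [this, smul_apply, inner_smul_right, Complex.re_ofReal_mul]
    rw [e]
    have : ∑ k ∈ Finset.range m, 2^k * (inner ℂ ξ (V.π (a k) ξ)).re ≤ ∑ k ∈ Finset.range m, (1/4) * (1/2 : ℝ)^k := by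
      refine Finset.sum_le_sum fun k _ => ?_
      have := haξ k
      calc 2^k * (inner ℂ ξ (V.π (a k) ξ)).re ≤ 2^k * (1/4)^(k+1) := by gcongr
        _ = (1/4) * (2 * (1/4))^k := by rw [mul_pow]; ring
        _ = _ := by norm_num
    have h3 : ∑ k ∈ Finset.range m, (1/4) * (1/2 : ℝ)^k ≤ 1/2 := by
      rw [← Finset.mul_sum, geom_sum_eq (by norm_num)]
      have : 0 < (1/2:ℝ)^m := by positivity
      have e3 : ((1/2:ℝ)^m - 1) / (1/2 - 1) = 2 * (1 - (1/2)^m) := by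
        rw [div_eq_iff (by norm_num)]; ring
      rw [e3]
      linarith
    linarith
  have hbξ : ∀ m, 1/2 ≤ (inner ℂ ξ (V.π (b m) ξ)).re := by
    intro m
    have hle : 1 - (1/4 : ℝ) • T m ≤ b m := by
      have h := star_left_conjugate_nonneg (hb0 m) (1 - (1/2 : ℝ) • T m)
      have hTs : star (T m) = T m := IsSelfAdjoint.of_nonneg (le_trans zero_le_one (hT1 m))
      have e : star (1 - (1/2 : ℝ) • T m) * b m * (1 - (1/2 : ℝ) • T m) = b m - (1 - (1/4 : ℝ) • T m) := by
        simp only [star_sub, star_one, star_smul, hTs, sub_mul, mul_sub, one_mul, mul_one, smul_mul_assoc, mul_smul_comm, hTb, hbT,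
          mul_assoc, star_trivial, smul_smul]
        module
      rw [e] at h
      exact sub_nonneg.mp h
    have h := V.inner_mono hle ξ
    have e : V.π (1 - (1/4 : ℝ) • T m) = 1 - ((1/4:ℝ):ℂ) • V.π (T m) := by
      rw [map_sub, map_one, ← map_smul, Complex.coe_smul]
    rw [e, sub_apply, smul_apply, inner_sub_right, inner_smul_right, Complex.sub_re, Complex.re_ofReal_mul, one_apply_eq_self,
      inner_self_eq_norm_sq_to_K, hξ] at h
    simp at h
    have := hTξ m
    linarith
  have hc12 : 1/2 ≤ (inner ℂ ξ (V.π c ξ)).re :=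
    ge_of_tendsto' ((Complex.continuous_re.tendsto _).comp (hc ξ ξ)) hbξ
  have hc0 : 0 ≤ c := V.nonneg c fun η => ge_of_tendsto' (hc η η) fun m => V.inner_nonneg (hb0 m) η
  have hcb : ∀ m, c ≤ b m := by
    intro m
    rw [← sub_nonneg]
    refine V.nonneg _ fun η => ?_
    rw [map_sub, sub_apply, inner_sub_right, sub_nonneg]
    refine le_of_tendsto (hc η η) ?_
    have : ∀ᶠ n in (hyperfilter ℕ : Filter ℕ), m ≤ n := Nat.hyperfilter_le_atTop (eventually_ge_atTop m)
    filter_upwards [this] with n hn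
    have := V.inner_nonneg (sub_nonneg.mpr (hanti hn)) η
    rw [map_sub, sub_apply, inner_sub_right, sub_nonneg] at this
    exact this
  have hbt : ∀ k, (S.t (b (k+1))).re ≤ 2 * (1/2)^k := by
    intro k
    have g1 := S.t_mul_nonneg (hb0 (k+1)) (y := T (k+1) - (2^k:ℝ) • a k) (by
      simp only [T, Finset.sum_range_succ, ← add_assoc, add_sub_cancel_right]
      exact le_trans zero_le_one (hT1 k))
    have g2 := S.t_mul_nonneg (sub_nonneg.mpr (hb1 (k+1))) (sub_nonneg.mpr (ha1 k))
    have ht1 : (S.t 1).re = 1 := by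
      have := S.norm_sq 1
      rw [h1] at this; simp at this; exact this.symm
    rw [mul_sub, hbT, map_sub, Complex.sub_re, ht1, mul_smul_comm, ← Complex.coe_smul, map_smul, smul_eq_mul, Complex.re_ofReal_mul] at g1
    have e : (1 - b (k+1)) * (1 - a k) = (1 - a k) - (b (k+1) - b (k+1) * a k) := by noncomm_ring
    rw [e, map_sub, map_sub S.t (b (k+1)), Complex.sub_re, Complex.sub_re] at g2
    have g3 := hat k
    have : (S.t (b (k+1) * a k)).re ≤ (1/2)^k := by
      have : (1/2:ℝ)^k * 2^k = 1 := by rw [← mul_pow]; norm_num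
      have h0 : 0 < (1/2:ℝ)^k := by positivity
      nlinarith
    linarith
  have hct : (S.t c).re ≤ 0 := by
    have hlim : Tendsto (fun k : ℕ => 2 * (1/2:ℝ)^k) atTop (𝓝 (2 * 0)) :=
      (tendsto_pow_atTop_nhds_zero_of_lt_one (by norm_num) (by norm_num)).const_mul 2
    rw [mul_zero] at hlim
    exact ge_of_tendsto' hlim fun k => (S.t_mono (hcb (k+1))).trans (hbt k)
  obtain ⟨s, hs⟩ := CStarAlgebra.nonneg_iff_eq_star_mul_self.mp hc0
  rw [hs, ← S.norm_sq] at hct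
  have : S.Λ s = 0 := by
    have : ‖S.Λ s‖ = 0 := by nlinarith [norm_nonneg (S.Λ s)]
    exact norm_eq_zero.mp this
  rw [hs, hf s this] at hc12
  simp at hc12
  linarith
end C
end CDP

end

noncomputable section
open scoped Classical ComplexOrder InnerProductSpace
open Filter Topology
namespace CDP
section D
variable {A K H : Type} [CStarAlgebra A] [PartialOrder A] [StarOrderedRing A]
  [NormedAddCommGroup K] [InnerProductSpace ℂ K]
  [NormedAddCommGroup H] [InnerProductSpace ℂ H] [CompleteSpace H]
  (S : TrRep A K) (V : VN A H)

/-- vector functional -/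
def VN.vec (ζ ξ : H) : A →ₗ[ℂ] ℂ where
  toFun x := inner ℂ ζ (V.π x ξ)
  map_add' x y := by rw [map_add, add_apply, inner_add_right]
  map_smul' c x := by rw [map_smul, smul_apply, inner_smul_right]; rfl

/-- span of vector functionals -/
def VN.W : Submodule ℂ (A →ₗ[ℂ] ℂ) := Submodule.span ℂ {f | ∃ ζ ξ, f = V.vec ζ ξ}

/-- normal functionals -/
def VN.Nrm (f : A →ₗ[ℂ] ℂ) : Prop := ∀ ε > 0, ∃ g ∈ V.W, ∀ x, ‖f x - g x‖ ≤ ε * ‖x‖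

lemma VN.Nrm_of_W {f : A →ₗ[ℂ] ℂ} (hf : f ∈ V.W) : V.Nrm f := fun ε hε =>
  ⟨f, hf, fun x => by rw [sub_self, norm_zero]; positivity⟩

lemma VN.Nrm_approx {f : A →ₗ[ℂ] ℂ} (h : ∀ ε > 0, ∃ g, V.Nrm g ∧ ∀ x, ‖f x - g x‖ ≤ ε * ‖x‖) :
    V.Nrm f := by
  intro ε hε
  obtain ⟨g, hg, h1⟩ := h (ε/2) (by positivity)
  obtain ⟨g', hg', h2⟩ := hg (ε/2) (by positivity)
  refine ⟨g', hg', fun x => ?_⟩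
  calc ‖f x - g' x‖ = ‖(f x - g x) + (g x - g' x)‖ := by rw [sub_add_sub_cancel]
    _ ≤ ε/2 * ‖x‖ + ε/2 * ‖x‖ := (norm_add_le _ _).trans (add_le_add (h1 x) (h2 x))
    _ = _ := by ring

lemma VN.Nrm_add {f g : A →ₗ[ℂ] ℂ} (hf : V.Nrm f) (hg : V.Nrm g) : V.Nrm (f + g) := by
  intro ε hε
  obtain ⟨f', hf', h1⟩ := hf (ε/2) (by positivity)
  obtain ⟨g', hg', h2⟩ := hg (ε/2) (by positivity)
  refine ⟨f' + g', V.W.add_mem hf' hg', fun x => ?_⟩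
  calc ‖(f + g) x - (f' + g') x‖ = ‖(f x - f' x) + (g x - g' x)‖ := by
        rw [LinearMap.add_apply, LinearMap.add_apply]; congr 1; ring
    _ ≤ ε/2 * ‖x‖ + ε/2 * ‖x‖ := (norm_add_le _ _).trans (add_le_add (h1 x) (h2 x))
    _ = _ := by ring

lemma VN.Nrm_smul {f : A →ₗ[ℂ] ℂ} (hf : V.Nrm f) (c : ℂ) : V.Nrm (c • f) := by
  intro ε hε
  obtain ⟨f', hf', h1⟩ := hf (ε/(‖c‖+1)) (by positivity)
  refine ⟨c • f', V.W.smul_mem c hf', fun x => ?_⟩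
  rw [LinearMap.smul_apply, LinearMap.smul_apply, ← smul_sub, norm_smul]
  have := h1 x
  calc ‖c‖ * ‖f x - f' x‖ ≤ (‖c‖+1) * (ε/(‖c‖+1) * ‖x‖) := by gcongr; linarith
    _ = _ := by field_simp

/-- two sided multiplication -/
def mulLR (a b : A) : A →ₗ[ℂ] A := (LinearMap.mulLeft ℂ a).comp (LinearMap.mulRight ℂ b)

lemma mulLR_apply (a b x : A) : mulLR a b x = a * (x * b) := rfl

lemma VN.W_mul {f : A →ₗ[ℂ] ℂ} (hf : f ∈ V.W) (a b : A) : f.comp (mulLR a b) ∈ V.W := by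
  have : V.W ≤ V.W.comap (LinearMap.lcomp ℂ ℂ (mulLR a b)) := by
    refine Submodule.span_le.mpr ?_
    rintro _ ⟨ζ, ξ, rfl⟩
    refine Submodule.subset_span ⟨V.π (star a) ζ, V.π b ξ, ?_⟩
    ext x
    change inner ℂ ζ (V.π (a * (x * b)) ξ) = inner ℂ (V.π (star a) ζ) (V.π x (V.π b ξ))
    rw [map_star, ContinuousLinearMap.star_eq_adjoint, ContinuousLinearMap.adjoint_inner_left,
      map_mul, map_mul]; rfl
  exact this hf

lemma VN.Nrm_mul {f : A →ₗ[ℂ] ℂ} (hf : V.Nrm f) (a b : A) : V.Nrm (f.comp (mulLR a b)) := by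
  intro ε hε
  obtain ⟨f', hf', h1⟩ := hf (ε/(‖a‖*‖b‖+1)) (by positivity)
  refine ⟨_, V.W_mul hf' a b, fun x => ?_⟩
  have := h1 (mulLR a b x)
  have h2 : ‖mulLR a b x‖ ≤ (‖a‖*‖b‖+1) * ‖x‖ := by
    rw [mulLR_apply]
    have h3 : ‖a * (x * b)‖ ≤ ‖a‖ * (‖x‖ * ‖b‖) := (norm_mul_le _ _).trans (by gcongr; exact norm_mul_le _ _)
    nlinarith [norm_nonneg x]
  calc _ ≤ ε/(‖a‖*‖b‖+1) * ‖mulLR a b x‖ := this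
    _ ≤ ε/(‖a‖*‖b‖+1) * ((‖a‖*‖b‖+1) * ‖x‖) := by gcongr
    _ = _ := by field_simp

/-- WOT continuity on bounded sequences. -/
lemma VN.Nrm_wot {f : A →ₗ[ℂ] ℂ} (hf : V.Nrm f) {x : ℕ → A} {y : A} {C : ℝ} (hC : ∀ n, ‖x n‖ ≤ C)
    (hy : ‖y‖ ≤ C)
    (h : ∀ ξ η : H, Tendsto (fun n => inner ℂ ξ (V.π (x n) η)) (hyperfilter ℕ) (𝓝 (inner ℂ ξ (V.π y η)))) :
    Tendsto (fun n => f (x n)) (hyperfilter ℕ) (𝓝 (f y)) := by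
  have hW : ∀ g ∈ V.W, Tendsto (fun n => g (x n)) (hyperfilter ℕ) (𝓝 (g y)) := by
    intro g hg
    refine Submodule.span_induction ?_ ?_ ?_ ?_ hg
    · rintro _ ⟨ζ, ξ, rfl⟩; exact h ζ ξ
    · simp
    · intro f g _ _ hf hg; exact hf.add hg
    · intro c f _ hf; exact hf.const_smul c
  have hC0 : 0 ≤ C := (norm_nonneg _).trans hy
  rw [Metric.tendsto_nhds]
  intro ε hε
  obtain ⟨g, hg, h1⟩ := hf (ε/(4*(C+1))) (by positivity)
  have h2 := Metric.tendsto_nhds.mp (hW g hg) (ε/4) (by positivity)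
  have key : ∀ z, ‖z‖ ≤ C → ‖f z - g z‖ ≤ ε/4 := by
    intro z hz
    refine (h1 z).trans ?_
    calc ε/(4*(C+1)) * ‖z‖ ≤ ε/(4*(C+1)) * (C+1) := by gcongr; linarith
      _ = ε/4 := by field_simp
  filter_upwards [h2] with n hn
  rw [dist_eq_norm] at hn ⊢
  have e : f (x n) - f y = (f (x n) - g (x n)) + (g (x n) - g y) - (f y - g y) := by ring
  rw [e]
  have k1 := key _ (hC n)
  have k2 := key _ hy
  calc _ ≤ ‖(f (x n) - g (x n)) + (g (x n) - g y)‖ + ‖f y - g y‖ := norm_sub_le _ _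
    _ ≤ ‖(f (x n) - g (x n))‖ + ‖(g (x n) - g y)‖ + ‖f y - g y‖ := by gcongr; exact norm_add_le _ _
    _ < ε := by linarith

variable [CompleteSpace K]

lemma exists_seed (h1 : ‖S.Λ 1‖ = 1) (hf : ∀ x, S.Λ x = 0 → x = 0) :
    ∃ c : K, V.Nrm ((innerSL ℂ c).toLinearMap.comp S.Λ) ∧ inner ℂ c (S.Λ 1) = 1 := by
  have hH : ∃ ξ : H, ‖ξ‖ = 1 := by
    have hne : ∃ η : H, η ≠ 0 := by
      by_contra hcon
      push Not at hcon
      have : V.π 1 = 0 := by ext η; rw [hcon η]; simp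
      have h2 := V.norm_π 1
      rw [this, norm_zero] at h2
      have h3 : (1 : A) = 0 := norm_eq_zero.mp h2.symm
      rw [h3, map_zero, norm_zero] at h1
      exact zero_ne_one h1
    obtain ⟨η, hη⟩ := hne
    exact ⟨((‖η‖⁻¹ : ℝ) : ℂ) • η, by rw [norm_smul]; simp [norm_ne_zero_iff.mpr hη]⟩
  obtain ⟨ξ, hξ⟩ := hH
  obtain ⟨δ, hδ, hno⟩ := sing_excl S V h1 hf ξ hξ
  let j : A →ₗ[ℂ] WithLp 2 (K × H) :=
    (WithLp.linearEquiv 2 ℂ (K × H)).symm.toLinearMap.comp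
      (S.Λ.prod ((ContinuousLinearMap.apply ℂ H ξ).toLinearMap.comp V.π.toAlgHom.toLinearMap))
  have hj1 : ∀ x, (j x).fst = S.Λ x := fun x => rfl
  have hj2 : ∀ x, (j x).snd = V.π x ξ := fun x => rfl
  let G : Submodule ℂ (WithLp 2 (K × H)) := LinearMap.range j
  let p : WithLp 2 (K × H) := WithLp.toLp 2 (S.Λ 1, 0)
  have hp : p ∉ G.topologicalClosure := by
    intro hp
    have hp : p ∈ closure (G : Set (WithLp 2 (K × H))) := hp
    obtain ⟨q, ⟨x, rfl⟩, hq⟩ := Metric.mem_closure_iff.mp hp δ hδ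
    have hq2 : ‖p - j x‖ ^ 2 < δ ^ 2 := by
      rw [dist_eq_norm] at hq; gcongr
    rw [WithLp.prod_norm_sq_eq_of_L2] at hq2
    have e1 : (p - j x).fst = - S.Λ (x - 1) := by
      change S.Λ 1 - S.Λ x = _
      rw [map_sub, neg_sub]
    have e2 : (p - j x).snd = - V.π x ξ := by
      change 0 - V.π x ξ = _
      rw [zero_sub]
    rw [e1, e2, norm_neg, norm_neg] at hq2
    refine hno x ?_ ?_
    · refine abs_le_of_sq_le_sq' (b := δ) ?_ hδ.le |>.2
      nlinarith [sq_nonneg ‖V.π x ξ‖]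
    · refine abs_le_of_sq_le_sq' (b := δ) ?_ hδ.le |>.2
      nlinarith [sq_nonneg ‖S.Λ (x-1)‖]
  rw [← Submodule.orthogonal_orthogonal_eq_closure, Submodule.mem_orthogonal] at hp
  push Not at hp
  obtain ⟨v, hv, hvp⟩ := hp
  have hv1 : ∀ x, inner ℂ v.fst (S.Λ x) = - inner ℂ v.snd (V.π x ξ) := by
    intro x
    have := (Submodule.mem_orthogonal' G v).mp hv (j x) ⟨x, rfl⟩
    exact eq_neg_of_add_eq_zero_left this
  have hvp' : inner ℂ v.fst (S.Λ 1) ≠ 0 := by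
    intro h0
    apply hvp
    change inner ℂ v.fst (S.Λ 1) + inner ℂ v.snd (0:H) = 0
    rw [h0, inner_zero_right, add_zero]
  set s := inner ℂ v.fst (S.Λ 1)
  refine ⟨(starRingEnd ℂ s⁻¹) • v.fst, ?_, ?_⟩
  · have : ((innerSL ℂ ((starRingEnd ℂ s⁻¹) • v.fst)).toLinearMap.comp S.Λ) = (- s⁻¹) • V.vec v.snd ξ := by
      ext x
      change inner ℂ ((starRingEnd ℂ s⁻¹) • v.fst) (S.Λ x) = (- s⁻¹) • inner ℂ v.snd (V.π x ξ)
      rw [inner_smul_left, hv1, smul_eq_mul]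
      simp
    rw [this]
    exact V.Nrm_of_W (V.W.smul_mem _ (Submodule.subset_span ⟨_, _, rfl⟩))
  · rw [inner_smul_left]
    simp only [RingHomCompTriple.comp_apply, RingHom.id_apply]
    exact inv_mul_cancel₀ hvp'

end D
end CDP

end

noncomputable section
open scoped Classical ComplexOrder InnerProductSpace
open Filter Topology
namespace CDP
section E
variable {A K H : Type} [CStarAlgebra A] [PartialOrder A] [StarOrderedRing A]
  [NormedAddCommGroup K] [InnerProductSpace ℂ K] [CompleteSpace K]
  [NormedAddCommGroup H] [InnerProductSpace ℂ H] [CompleteSpace H]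
  (S : TrRep A K) (V : VN A H)

lemma norm_one_le_one (A : Type) [CStarAlgebra A] : ‖(1:A)‖ ≤ 1 := by
  have := CStarRing.norm_star_mul_self (x := (1:A))
  rw [star_one, one_mul] at this
  nlinarith [norm_nonneg (1:A)]

/-- two sided multiplication operator on the GNS space. -/
def TrRep.op (a b : A) : K →L[ℂ] K := (S.Λ.comp (mulLR a b)).extendOfNorm S.Λ

lemma TrRep.op_bound (a b x : A) : ‖S.Λ.comp (mulLR a b) x‖ ≤ (‖a‖ * ‖b‖) * ‖S.Λ x‖ := by
  change ‖S.Λ (a * (x * b))‖ ≤ _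
  refine (S.norm_mul_left _ _).trans ?_
  have := S.norm_mul_right x b
  calc ‖a‖ * ‖S.Λ (x * b)‖ ≤ ‖a‖ * (‖S.Λ x‖ * ‖b‖) := by gcongr
    _ = _ := by ring

lemma TrRep.op_apply (hd : DenseRange S.Λ) (a b x : A) : S.op a b (S.Λ x) = S.Λ (a * (x * b)) :=
  LinearMap.extendOfNorm_eq hd ⟨_, S.op_bound a b⟩ x

lemma TrRep.op_norm (hd : DenseRange S.Λ) (a b : A) (k : K) : ‖S.op a b k‖ ≤ (‖a‖ * ‖b‖) * ‖k‖ :=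
  LinearMap.norm_extendOfNorm_apply_le hd _ (S.op_bound a b) k

lemma clm_ext (hd : DenseRange S.Λ) {f g : K →L[ℂ] K} (h : ∀ x, f (S.Λ x) = g (S.Λ x)) : f = g := by
  ext k
  exact congrFun (hd.equalizer f.continuous g.continuous (funext h)) k

theorem exists_normal (h1 : ‖S.Λ 1‖ = 1) (hf : ∀ x, S.Λ x = 0 → x = 0) (hd : DenseRange S.Λ) :
    ∃ S' : TrRep A K, V.Nrm S'.t ∧ S'.Λ 1 ≠ 0 ∧
      ∀ ε > 0, ∃ δ > 0, ∀ x : A, ‖x‖ ≤ 2 → ‖S.Λ x‖ ≤ δ → ‖S'.Λ x‖ ≤ ε := by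
  let D : Set K := {c | V.Nrm ((innerSL ℂ c).toLinearMap.comp S.Λ) ∧ inner ℂ c (S.Λ 1) = 1}
  have hDne : D.Nonempty := exists_seed S V h1 hf
  have hDconv : Convex ℝ D := by
    intro c hc d hd a b ha hb hab
    refine ⟨?_, ?_⟩
    · have : ((innerSL ℂ (a • c + b • d)).toLinearMap.comp S.Λ) =
        (a : ℂ) • ((innerSL ℂ c).toLinearMap.comp S.Λ) + (b : ℂ) • ((innerSL ℂ d).toLinearMap.comp S.Λ) := by
        ext x
        change inner ℂ (a • c + b • d) (S.Λ x) = (a : ℂ) • inner ℂ c (S.Λ x) + (b:ℂ) • inner ℂ d (S.Λ x)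
        rw [inner_add_left, ← Complex.coe_smul, ← Complex.coe_smul, inner_smul_left, inner_smul_left]
        simp
      rw [this]
      exact V.Nrm_add (V.Nrm_smul hc.1 _) (V.Nrm_smul hd.1 _)
    · rw [inner_add_left, ← Complex.coe_smul, ← Complex.coe_smul, inner_smul_left, inner_smul_left, hc.2, hd.2]
      simp
      exact_mod_cast hab
  have hDcl : IsClosed D := by
    rw [← closure_subset_iff_isClosed]
    intro c hc
    refine ⟨V.Nrm_approx fun ε hε => ?_, ?_⟩
    · obtain ⟨d, hd, hcd⟩ := Metric.mem_closure_iff.mp hc ε hε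
      refine ⟨_, hd.1, fun x => ?_⟩
      change ‖inner ℂ c (S.Λ x) - inner ℂ d (S.Λ x)‖ ≤ _
      rw [← inner_sub_left]
      refine (norm_inner_le_norm _ _).trans ?_
      rw [dist_eq_norm] at hcd
      have := S.norm_le x
      rw [h1, mul_one] at this
      gcongr
    · have hcl : IsClosed {c : K | inner ℂ c (S.Λ 1) = 1} :=
        isClosed_eq (continuous_id.inner continuous_const) continuous_const
      exact hcl.closure_subset_iff.mpr (fun d hd => hd.2) hc
  obtain ⟨κ, hκ, hfix⟩ := exists_min D hDne hDconv
  rw [hDcl.closure_eq] at hκ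
  have hop1 : S.op 1 1 = ContinuousLinearMap.id ℂ K := clm_ext S hd fun x => by
    rw [S.op_apply hd]; simp
  have hopmul : ∀ a b a' b' k, S.op a b (S.op a' b' k) = S.op (a * a') (b' * b) k := by
    intro a b a' b' k
    have : (S.op a b).comp (S.op a' b') = S.op (a * a') (b' * b) := clm_ext S hd fun x => by
      rw [ContinuousLinearMap.comp_apply, S.op_apply hd, S.op_apply hd, S.op_apply hd]
      congr 1; noncomm_ring
    exact congrArg (fun f : K →L[ℂ] K => f k) this
  have hadj : ∀ a b k l, inner ℂ (S.op a b k) l = inner ℂ k (S.op (star a) (star b) l) := by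
    intro a b k l
    have : S.op a b = ContinuousLinearMap.adjoint (S.op (star a) (star b)) := by
      refine clm_ext S hd fun x => ?_
      refine ext_inner_right ℂ fun l => ?_
      rw [ContinuousLinearMap.adjoint_inner_left]
      have hc1 : Continuous fun l : K => inner ℂ (S.op a b (S.Λ x)) l := by fun_prop
      have hc2 : Continuous fun l : K => inner ℂ (S.Λ x) (S.op (star a) (star b) l) := by fun_prop
      refine congrFun (hd.equalizer hc1 hc2 (funext fun y => ?_)) l
      simp only [Function.comp_apply]
      rw [S.op_apply hd, S.op_apply hd, S.inner_eq, S.inner_eq]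
      simp only [star_mul]
      rw [mul_assoc, mul_assoc, S.tr, ]
      simp only [mul_assoc]
    rw [this, ContinuousLinearMap.adjoint_inner_left]
  have hU : ∀ u ∈ unitary A, S.op u (star u) κ = κ := by
    intro u hu
    have huu := Unitary.star_mul_self_of_mem hu
    have huu' := Unitary.mul_star_self_of_mem hu
    refine hfix _ (fun k => ?_) (fun d hd' => ⟨?_, ?_⟩)
    · have : inner ℂ (S.op u (star u) k) (S.op u (star u) k) = inner ℂ k k := by
        rw [hadj, hopmul, star_star, huu, hop1]; rfl
      rw [inner_self_eq_norm_sq_to_K, inner_self_eq_norm_sq_to_K] at this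
      have : ‖S.op u (star u) k‖ ^ 2 = ‖k‖ ^ 2 := by exact_mod_cast this
      exact (sq_eq_sq₀ (norm_nonneg _) (norm_nonneg _)).mp this
    · have := V.Nrm_mul hd'.1 (star u) u
      convert this using 1
      ext x
      change inner ℂ (S.op u (star u) d) (S.Λ x) = inner ℂ d (S.Λ (star u * (x * u)))
      rw [hadj, S.op_apply hd, star_star]
    · rw [hadj, S.op_apply hd, star_star, one_mul, huu]; exact hd'.2
  have hadd : ∀ x y k, S.op (x + y) 1 k = S.op x 1 k + S.op y 1 k := by
    intro x y k
    have : S.op (x + y) 1 = S.op x 1 + S.op y 1 := clm_ext S hd fun z => by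
      rw [add_apply, S.op_apply hd, S.op_apply hd, S.op_apply hd, add_mul, map_add]
    rw [this]; rfl
  have hsmul : ∀ (c : ℂ) x k, S.op (c • x) 1 k = c • S.op x 1 k := by
    intro c x k
    have : S.op (c • x) 1 = c • S.op x 1 := clm_ext S hd fun z => by
      rw [smul_apply, S.op_apply hd, S.op_apply hd, smul_mul_assoc, map_smul]
    rw [this]; rfl
  let Λ' : A →ₗ[ℂ] K :=
    { toFun := fun x => S.op x 1 κ, map_add' := fun x y => hadd x y κ, map_smul' := fun c x => hsmul c x κ }
  let t' : A →ₗ[ℂ] ℂ := (innerSL ℂ κ).toLinearMap.comp Λ'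
  have ht' : ∀ x, t' x = inner ℂ κ (S.op x 1 κ) := fun x => rfl
  have htu : ∀ u ∈ unitary A, ∀ y, t' (u * y * star u) = t' y := by
    intro u hu y
    have huu := Unitary.star_mul_self_of_mem hu
    have e : S.op (u * y * star u) 1 κ = S.op u (star u) (S.op y 1 κ) := by
      conv_lhs => rw [← hU u hu]
      rw [hopmul, hopmul]
      simp only [mul_assoc, huu, mul_one, one_mul]
    rw [ht', ht', e]
    have := hadj u (star u) κ (S.op u (star u) (S.op y 1 κ))
    rw [hU u hu, hopmul (star u), star_star, huu, hop1] at this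
    exact this
  let S' : TrRep A K :=
    { Λ := Λ'
      t := t'
      inner_eq := fun x y => by
        change inner ℂ (S.op x 1 κ) (S.op y 1 κ) = inner ℂ κ (S.op (star x * y) 1 κ)
        rw [hadj, hopmul]; simp
      tr := fun x y => by
        have := of_unitary (t'.comp (LinearMap.mulRight ℂ y)) (t'.comp (LinearMap.mulLeft ℂ y)) (by
          intro u hu
          change t' (u * y) = t' (y * u)
          have := htu u hu (y * u)
          have huu' := Unitary.mul_star_self_of_mem hu
          rw [← this]
          congr 1
          simp only [mul_assoc, huu', mul_one])
        exact congrArg (fun f => f x) this }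
  refine ⟨S', ?_, ?_, ?_⟩
  · refine V.Nrm_approx fun ε hε => ?_
    obtain ⟨r, hr⟩ := hd.exists_dist_lt κ (ε := ε / (‖κ‖ + 1)) (by positivity)
    refine ⟨_, V.Nrm_mul hκ.1 1 r, fun x => ?_⟩
    change ‖inner ℂ κ (S.op x 1 κ) - inner ℂ κ (S.Λ (1 * (x * r)))‖ ≤ _
    have e : S.Λ (1 * (x * r)) = S.op x 1 (S.Λ r) := by rw [S.op_apply hd]; simp
    rw [e, ← inner_sub_right, ← map_sub]
    rw [dist_eq_norm] at hr
    calc _ ≤ ‖κ‖ * ‖S.op x 1 (κ - S.Λ r)‖ := norm_inner_le_norm _ _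
      _ ≤ ‖κ‖ * ((‖x‖ * ‖(1:A)‖) * ‖κ - S.Λ r‖) := by gcongr; exact S.op_norm hd _ _ _
      _ ≤ (‖κ‖ + 1) * ((‖x‖ * 1) * (ε / (‖κ‖ + 1))) := by
        have : ‖(1:A)‖ ≤ 1 := norm_one_le_one A
        gcongr; linarith
      _ = ε * ‖x‖ := by field_simp
  · change S.op 1 1 κ ≠ 0
    rw [hop1]
    intro h0
    have h0 : κ = 0 := h0
    have := hκ.2
    rw [h0, inner_zero_left] at this
    exact zero_ne_one this
  · intro ε hε
    obtain ⟨r, hr⟩ := hd.exists_dist_lt κ (ε := ε / 4) (by positivity)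
    rw [dist_eq_norm] at hr
    refine ⟨ε / (2 * (‖r‖ + 1)), by positivity, fun x hx hxδ => ?_⟩
    change ‖S.op x 1 κ‖ ≤ ε
    have e : S.op x 1 κ = S.Λ (x * r) + S.op x 1 (κ - S.Λ r) := by
      rw [map_sub, S.op_apply hd]; simp
    have b1 : ‖S.Λ (x * r)‖ ≤ ε / 2 := by
      refine (S.norm_mul_right x r).trans ?_
      calc ‖S.Λ x‖ * ‖r‖ ≤ (ε / (2 * (‖r‖ + 1))) * (‖r‖ + 1) := by gcongr; linarith
        _ = _ := by field_simp
    have b2 : ‖S.op x 1 (κ - S.Λ r)‖ ≤ ε / 2 := by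
      refine (S.op_norm hd _ _ _).trans ?_
      have : ‖(1:A)‖ ≤ 1 := norm_one_le_one A
      calc (‖x‖ * ‖(1:A)‖) * ‖κ - S.Λ r‖ ≤ (2 * 1) * (ε/4) := by gcongr
        _ = _ := by ring
    rw [e]
    have := norm_add_le (S.Λ (x * r)) (S.op x 1 (κ - S.Λ r))
    linarith
end E
end CDP

end

noncomputable section
open scoped Classical ComplexOrder InnerProductSpace
open Filter Topology
namespace CDP
section F
variable {A K H : Type} [CStarAlgebra A] [PartialOrder A] [StarOrderedRing A]
  [NormedAddCommGroup K] [InnerProductSpace ℂ K]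
  [NormedAddCommGroup H] [InnerProductSpace ℂ H] [CompleteSpace H]
  (S : TrRep A K) (V : VN A H)

lemma complete_seq (hN : V.Nrm S.t) {x : ℕ → A} {C : ℝ} (hC : ∀ n, ‖x n‖ ≤ C) {κ : K}
    (hκ : Tendsto (fun n => S.Λ (x n)) atTop (𝓝 κ)) : ∃ y, ‖y‖ ≤ C ∧ S.Λ y = κ := by
  obtain ⟨y, hy, hlim⟩ := V.wot x C hC
  refine ⟨y, hy, ?_⟩
  have key : ∀ m, ‖S.Λ (y - x m)‖ ≤ ‖κ - S.Λ (x m)‖ := by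
    intro m
    have h1 := V.Nrm_wot (V.Nrm_mul hN (star (y - x m)) 1) hC hy hlim
    have h2 := h1.sub_const (S.t.comp (mulLR (star (y - x m)) 1) (x m))
    have e : ∀ z, S.t.comp (mulLR (star (y - x m)) 1) z - S.t.comp (mulLR (star (y - x m)) 1) (x m)
        = inner ℂ (S.Λ (y - x m)) (S.Λ z - S.Λ (x m)) := by
      intro z
      rw [← map_sub, ← map_sub, S.inner_eq, LinearMap.comp_apply, mulLR_apply, mul_one]
    simp only [e] at h2
    have h3 : Tendsto (fun n => inner ℂ (S.Λ (y - x m)) (S.Λ (x n) - S.Λ (x m))) (hyperfilter ℕ)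
        (𝓝 (inner ℂ (S.Λ (y - x m)) (κ - S.Λ (x m)))) :=
      Tendsto.inner tendsto_const_nhds ((hκ.mono_left Nat.hyperfilter_le_atTop).sub_const _)
    have h4 := tendsto_nhds_unique h2 h3
    rw [← map_sub, inner_self_eq_norm_sq_to_K] at h4
    have h5 := norm_inner_le_norm (𝕜 := ℂ) (S.Λ (y - x m)) (κ - S.Λ (x m))
    rw [← h4] at h5
    simp only [Complex.coe_algebraMap, norm_pow, Complex.norm_real, norm_norm] at h5
    by_contra hcon
    push Not at hcon
    have h0 : 0 < ‖S.Λ (y - x m)‖ := (norm_nonneg _).trans_lt hcon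
    nlinarith
  have hz : Tendsto (fun m => κ - S.Λ (x m)) atTop (𝓝 0) := by
    simpa using hκ.const_sub κ
  have hz2 : Tendsto (fun m => S.Λ (y - x m)) atTop (𝓝 0) :=
    squeeze_zero_norm key (by simpa using hz.norm)
  simp only [map_sub] at hz2
  have hz3 : Tendsto (fun m => S.Λ y - S.Λ (x m)) atTop (𝓝 (S.Λ y - κ)) := hκ.const_sub _
  exact sub_eq_zero.mp (tendsto_nhds_unique hz3 hz2)

lemma complete_closure (hN : V.Nrm S.t) {D : Set A} {C : ℝ} (hC : ∀ x ∈ D, ‖x‖ ≤ C) {κ : K}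
    (hκ : κ ∈ closure (S.Λ '' D)) : ∃ y, ‖y‖ ≤ C ∧ S.Λ y = κ := by
  obtain ⟨k, hk, hlim⟩ := mem_closure_iff_seq_limit.mp hκ
  choose x hx hxk using hk
  refine complete_seq S V hN (x := x) (fun n => hC _ (hx n)) ?_
  simpa only [hxk] using hlim

lemma W_bound {g : A →ₗ[ℂ] ℂ} (hg : g ∈ V.W) :
    ∃ (F : Finset H) (C : ℝ), 0 ≤ C ∧ ∀ x, ‖g x‖ ≤ C * ∑ ξ ∈ F, ‖V.π x ξ‖ := by
  refine Submodule.span_induction ?_ ?_ ?_ ?_ hg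
  · rintro _ ⟨ζ, ξ, rfl⟩
    refine ⟨{ξ}, ‖ζ‖, norm_nonneg _, fun x => ?_⟩
    rw [Finset.sum_singleton]
    exact norm_inner_le_norm _ _
  · exact ⟨∅, 0, le_rfl, fun x => by simp⟩
  · rintro f g _ _ ⟨F, C, hC, h⟩ ⟨F', C', hC', h'⟩
    refine ⟨F ∪ F', C + C', by positivity, fun x => ?_⟩
    have a1 : ∑ ξ ∈ F, ‖V.π x ξ‖ ≤ ∑ ξ ∈ F ∪ F', ‖V.π x ξ‖ :=
      Finset.sum_le_sum_of_subset_of_nonneg Finset.subset_union_left (fun _ _ _ => norm_nonneg _)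
    have a2 : ∑ ξ ∈ F', ‖V.π x ξ‖ ≤ ∑ ξ ∈ F ∪ F', ‖V.π x ξ‖ :=
      Finset.sum_le_sum_of_subset_of_nonneg Finset.subset_union_right (fun _ _ _ => norm_nonneg _)
    calc ‖f x + g x‖ ≤ ‖f x‖ + ‖g x‖ := norm_add_le _ _
      _ ≤ C * ∑ ξ ∈ F ∪ F', ‖V.π x ξ‖ + C' * ∑ ξ ∈ F ∪ F', ‖V.π x ξ‖ := by
        refine add_le_add ((h x).trans ?_) ((h' x).trans ?_) <;> gcongr
      _ = _ := by ring
  · rintro c f _ ⟨F, C, hC, h⟩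
    refine ⟨F, ‖c‖ * C, by positivity, fun x => ?_⟩
    rw [LinearMap.smul_apply, norm_smul, mul_assoc]
    gcongr
    exact h x

lemma Λ_mul_left {z : A} (hz : S.Λ z = 0) (a : A) : S.Λ (a * z) = 0 := by
  have := S.norm_mul_left a z
  rw [hz, norm_zero, mul_zero] at this
  exact norm_le_zero_iff.mp this

lemma Λ_mul_right {z : A} (hz : S.Λ z = 0) (a : A) : S.Λ (z * a) = 0 := by
  have := S.norm_mul_right z a
  rw [hz, norm_zero, zero_mul] at this
  exact norm_le_zero_iff.mp this

lemma dom_span {j : A} (hj : S.Λ j = 0) {ξ : H}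
    (hξ : ξ ∈ Submodule.span ℂ {η : H | ∃ a ζ, η = V.π (a * j) ζ}) :
    ∃ h : A, 0 ≤ h ∧ S.Λ h = 0 ∧ ∀ η : H, ‖inner ℂ η ξ‖ ^ 2 ≤ (inner ℂ η (V.π h η)).re := by
  refine Submodule.span_induction ?_ ?_ ?_ ?_ hξ
  · rintro _ ⟨a, ζ, rfl⟩
    set z := a * j
    have hz : S.Λ z = 0 := Λ_mul_left S hj a
    refine ⟨(‖ζ‖ ^ 2 : ℝ) • (z * star z), smul_nonneg (by positivity) (mul_star_self_nonneg z), ?_, fun η => ?_⟩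
    · rw [← Complex.coe_smul, map_smul, Λ_mul_right S hz, smul_zero]
    · rw [← Complex.coe_smul, map_smul, smul_apply, inner_smul_right, Complex.re_ofReal_mul]
      have e : inner ℂ η (V.π z ζ) = inner ℂ (V.π (star z) η) ζ := by
        rw [map_star, ContinuousLinearMap.star_eq_adjoint, ContinuousLinearMap.adjoint_inner_left]
      have e2 : (inner ℂ η (V.π (z * star z) η)).re = ‖V.π (star z) η‖ ^ 2 := by
        have := V.inner_star_mul (star z) η
        rw [star_star] at this
        rw [this, Complex.ofReal_re]
      rw [e, e2, ← mul_pow]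
      have := norm_inner_le_norm (𝕜 := ℂ) (V.π (star z) η) ζ
      gcongr
      linarith
  · exact ⟨0, le_rfl, map_zero _, fun η => by simp⟩
  · rintro ξ ξ' _ _ ⟨h, h0, hΛ, hb⟩ ⟨h', h0', hΛ', hb'⟩
    refine ⟨(2:ℝ) • h + (2:ℝ) • h', add_nonneg (smul_nonneg (by norm_num) h0) (smul_nonneg (by norm_num) h0'), ?_, fun η => ?_⟩
    · rw [← Complex.coe_smul, ← Complex.coe_smul, map_add, map_smul, map_smul, hΛ, hΛ']; simp
    · rw [← Complex.coe_smul, ← Complex.coe_smul, map_add, map_smul, map_smul, add_apply, smul_apply, smul_apply,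
        inner_add_right, inner_add_right, inner_smul_right, inner_smul_right, Complex.add_re,
        Complex.re_ofReal_mul, Complex.re_ofReal_mul]
      have := norm_add_le (inner ℂ η ξ) (inner ℂ η ξ')
      have n1 := hb η
      have n2 := hb' η
      have : ‖inner ℂ η ξ + inner ℂ η ξ'‖ ^ 2 ≤ (‖inner ℂ η ξ‖ + ‖inner ℂ η ξ'‖) ^ 2 := by gcongr
      nlinarith [sq_nonneg (‖inner ℂ η ξ‖ - ‖inner ℂ η ξ'‖)]
  · rintro c ξ _ ⟨h, h0, hΛ, hb⟩
    refine ⟨(‖c‖ ^ 2 : ℝ) • h, smul_nonneg (by positivity) h0, ?_, fun η => ?_⟩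
    · rw [← Complex.coe_smul, map_smul, hΛ]; simp
    · rw [← Complex.coe_smul, map_smul, smul_apply, inner_smul_right, inner_smul_right,
        Complex.re_ofReal_mul, norm_mul, mul_pow]
      have := hb η
      gcongr

lemma approx_unit {j : A} (hj : S.Λ j = 0) (hj0 : j ≠ 0) (F : Finset H) (ε : ℝ) (hε : 0 < ε) :
    ∃ r : A, ‖r‖ ≤ 1 ∧ S.Λ (1 - r) = 0 ∧ ∀ ξ ∈ F, ‖V.π r ξ‖ ≤ ε := by
  have h1 : ∀ ξ : H, ∃ ξ' h, 0 ≤ h ∧ S.Λ h = 0 ∧ (∀ η : H, ‖inner ℂ η ξ'‖ ^ 2 ≤ (inner ℂ η (V.π h η)).re)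
      ∧ ‖ξ - ξ'‖ ≤ ε / 2 := by
    intro ξ
    obtain ⟨ξ', hξ', hd⟩ := Metric.mem_closure_iff.mp (V.ideal j hj0 ξ) (ε/2) (by positivity)
    obtain ⟨h, h0, h1, h2⟩ := dom_span S V hj hξ'
    exact ⟨ξ', h, h0, h1, h2, by rw [← dist_eq_norm]; exact hd.le⟩
  choose x' h hh0 hhΛ hhb hx' using h1
  set g := ∑ ξ ∈ F, h ξ
  have hg0 : 0 ≤ g := Finset.sum_nonneg fun ξ _ => hh0 ξ
  have hgΛ : S.Λ g = 0 := by rw [map_sum]; exact Finset.sum_eq_zero fun ξ _ => hhΛ ξ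
  have hhg : ∀ ξ ∈ F, h ξ ≤ g := fun ξ hξ => Finset.single_le_sum (f := h) (fun ζ _ => hh0 ζ) hξ
  have hbd : ∃ M : ℝ, 0 ≤ M ∧ ∀ ξ ∈ F, ‖x' ξ‖ ^ 2 ≤ M :=
    ⟨∑ ξ ∈ F, ‖x' ξ‖ ^ 2, by positivity, fun ξ hξ =>
      Finset.single_le_sum (f := fun ξ => ‖x' ξ‖ ^ 2) (fun ζ _ => by positivity) hξ⟩
  obtain ⟨M, hM0, hM⟩ := hbd
  obtain ⟨n, hn0, hn⟩ : ∃ n : ℝ, 0 < n ∧ M / n ≤ (ε/2)^4 := by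
    refine ⟨M / (ε/2)^4 + 1, by positivity, ?_⟩
    rw [div_le_iff₀ (by positivity)]
    have : (ε/2)^4 * (M / (ε/2)^4 + 1) = M + (ε/2)^4 := by field_simp
    rw [this]
    have : 0 < (ε/2)^4 := by positivity
    linarith
  have hng : 0 ≤ n • g := smul_nonneg hn0.le hg0
  obtain ⟨r, hr0, hr1, hrT, hTr⟩ := inv_exists (1 + n • g) (by simpa using hng)
  have hrs : star r = r := IsSelfAdjoint.of_nonneg hr0
  have hrn : ‖r‖ ≤ 1 := (CStarAlgebra.norm_le_one_iff_of_nonneg r hr0).mpr hr1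
  have han : ‖1 - r‖ ≤ 1 := (CStarAlgebra.norm_le_one_iff_of_nonneg (1-r) (sub_nonneg.mpr hr1)).mpr (by simpa using hr0)
  have ea2 : 1 - r = n • (g * r) := by
    rw [sub_eq_iff_eq_add, ← smul_mul_assoc]
    have : (1 + n • g) * r = n • g * r + r := by rw [add_mul, one_mul, add_comm]
    rw [← this, hTr]
  refine ⟨r, hrn, ?_, fun ξ hξ => ?_⟩
  · rw [ea2, ← Complex.coe_smul, map_smul, Λ_mul_right S hgΛ, smul_zero]
  · have b1 : ‖V.π r (x' ξ)‖ ≤ ε / 2 := by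
      have q1 := hhb ξ (V.π (r * r) (x' ξ))
      have q2 := V.inner_mono (hhg ξ hξ) (V.π (r * r) (x' ξ))
      have e1 : inner ℂ (V.π (r * r) (x' ξ)) (x' ξ) = ((‖V.π r (x' ξ)‖ ^ 2 : ℝ) : ℂ) := by
        have := V.inner_star_mul r (x' ξ)
        rw [hrs] at this
        rw [← this]
        have hs : V.π (r * r) = ContinuousLinearMap.adjoint (V.π (r * r)) := by
          rw [← ContinuousLinearMap.star_eq_adjoint, ← map_star, star_mul, hrs]
        conv_lhs => rw [hs]
        rw [ContinuousLinearMap.adjoint_inner_left]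
      have e2 : inner ℂ (V.π (r * r) (x' ξ)) (V.π g (V.π (r * r) (x' ξ))) =
          ((1/n : ℝ) : ℂ) * inner ℂ (x' ξ) (V.π (r * r * (1 - r) * r) (x' ξ)) := by
        have hs : V.π (r * r) = ContinuousLinearMap.adjoint (V.π (r * r)) := by
          rw [← ContinuousLinearMap.star_eq_adjoint, ← map_star, star_mul, hrs]
        conv_lhs => arg 2; rw [hs]
        rw [ContinuousLinearMap.adjoint_inner_left, ← inner_smul_right, ← smul_apply, ← map_smul, Complex.coe_smul,
          ea2, ← mul_apply_eq_comp, ← mul_apply_eq_comp, ← map_mul, ← map_mul]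
        have : (1/n) • (r * r * n • (g * r) * r) = r * r * (g * (r * r)) := by
          simp only [mul_smul_comm, smul_mul_assoc, smul_smul]
          have : 1 / n * n = 1 := by field_simp
          rw [this, one_smul]; noncomm_ring
        rw [this, mul_assoc (r * r) g]
      have q3 : (inner ℂ (x' ξ) (V.π (r * r * (1 - r) * r) (x' ξ))).re ≤ M := by
        refine (Complex.re_le_norm _).trans ((norm_inner_le_norm _ _).trans ?_)
        have h5 : ‖V.π (r * r * (1 - r) * r)‖ ≤ 1 := by
          rw [V.norm_π]
          calc _ ≤ ‖r‖ * ‖r‖ * ‖1 - r‖ * ‖r‖ := by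
                refine (norm_mul_le _ _).trans ?_
                gcongr
                refine (norm_mul_le _ _).trans ?_
                gcongr
                exact norm_mul_le _ _
            _ ≤ 1 * 1 * 1 * 1 := by gcongr
            _ = 1 := by norm_num
        have h6 := (V.π (r * r * (1 - r) * r)).le_of_opNorm_le h5 (x' ξ)
        have := hM ξ hξ
        nlinarith [norm_nonneg (x' ξ)]
      rw [e2, Complex.re_ofReal_mul] at q2
      rw [e1] at q1
      have q4 : ‖V.π r (x' ξ)‖ ^ 4 ≤ (ε/2)^4 := by
        have e3 : ‖((‖V.π r (x' ξ)‖ ^ 2 : ℝ) : ℂ)‖ ^ 2 = ‖V.π r (x' ξ)‖ ^ 4 := by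
          rw [Complex.norm_real, Real.norm_of_nonneg (by positivity)]; ring
        rw [e3] at q1
        have : 1 / n * (inner ℂ (x' ξ) (V.π (r * r * (1 - r) * r) (x' ξ))).re ≤ 1 / n * M := by gcongr
        have e4 : 1 / n * M = M / n := by ring
        linarith
      exact le_of_pow_le_pow_left₀ (by norm_num) (by positivity) q4
    have b2 : ‖V.π r (ξ - x' ξ)‖ ≤ ε / 2 := by
      have hπr : ‖V.π r‖ ≤ 1 := by rw [V.norm_π]; exact hrn
      have h7 := (V.π r).le_of_opNorm_le hπr (ξ - x' ξ)
      have h8 := hx' ξ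
      linarith
    have e : V.π r ξ = V.π r (x' ξ) + V.π r (ξ - x' ξ) := by rw [← map_add]; congr 1; abel
    rw [e]
    exact (norm_add_le _ _).trans (by linarith)

lemma normal_faithful (hN : V.Nrm S.t) (h1 : S.Λ 1 ≠ 0) (x : A) (hx : S.Λ x = 0) : x = 0 := by
  by_contra hx0
  have ht : ‖S.t 1‖ ≤ 0 := by
    refine le_of_forall_pos_le_add fun ε hε => ?_
    obtain ⟨g, hg, hgt⟩ := hN (ε/2) (by positivity)
    obtain ⟨F, C, hC, hb⟩ := W_bound V hg
    obtain ⟨r, hr, hr1, hrF⟩ := approx_unit S V hx hx0 F (ε / (2 * (C + 1) * (F.card + 1))) (by positivity)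
    have e : S.t 1 = S.t r := by
      rw [← sub_eq_zero, ← map_sub, S.t_eq, hr1, inner_zero_right]
    rw [e]
    have h2 := hgt r
    have h3 := hb r
    have h4 : ∑ ξ ∈ F, ‖V.π r ξ‖ ≤ F.card * (ε / (2 * (C + 1) * (F.card + 1))) := by
      rw [← nsmul_eq_mul]; exact Finset.sum_le_card_nsmul _ _ _ hrF
    have h5 : C * ∑ ξ ∈ F, ‖V.π r ξ‖ ≤ ε / 2 := by
      calc C * ∑ ξ ∈ F, ‖V.π r ξ‖ ≤ (C + 1) * ((F.card + 1) * (ε / (2 * (C + 1) * (F.card + 1)))) := by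
            gcongr
            · linarith
            · exact h4.trans (by gcongr; linarith)
        _ = ε / 2 := by field_simp
    have h6 : ‖S.t r‖ ≤ ‖S.t r - g r‖ + ‖g r‖ := by
      have := norm_add_le (S.t r - g r) (g r); rwa [sub_add_cancel] at this
    nlinarith
  have h2 := S.norm_sq 1
  have h3 : S.t 1 = 0 := norm_le_zero_iff.mp ht
  rw [star_one, one_mul, h3, Complex.zero_re] at h2
  exact h1 (norm_eq_zero.mp (by nlinarith [norm_nonneg (S.Λ 1)]))
end F
end CDP

end

noncomputable section
open scoped Classical ComplexOrder InnerProductSpace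
open Filter Topology
namespace CDP

lemma exists_min' {K : Type} [NormedAddCommGroup K] [InnerProductSpace ℂ K] [CompleteSpace K]
    (D : Set K) (hne : D.Nonempty) (hc : Convex ℝ D) :
    ∃ κ ∈ closure D, ∀ κ' ∈ closure D, ‖κ'‖ = ‖κ‖ → κ' = κ := by
  let _ := InnerProductSpace.complexToReal (G := K)
  obtain ⟨κ, hκ, hmin⟩ := exists_norm_eq_iInf_of_complete_convex (K := closure D) hne.closure
    isClosed_closure.isComplete hc.closure 0
  refine ⟨κ, hκ, fun κ' hκ' hn => ?_⟩
  have h1 := (norm_eq_iInf_iff_real_inner_le_zero hc.closure hκ).mp hmin κ' hκ'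
  have h2 : ‖κ' - κ‖ ^ 2 ≤ 0 := by
    have e := norm_sub_sq_real κ' κ
    have h3 : inner ℝ (0 - κ) (κ' - κ) = ‖κ‖ ^ 2 - inner ℝ κ' κ := by
      rw [zero_sub, inner_neg_left, inner_sub_right, real_inner_self_eq_norm_sq, real_inner_comm]
      ring
    rw [h3] at h1
    rw [e, hn]; linarith
  have h4 : ‖κ' - κ‖ = 0 := by nlinarith [norm_nonneg (κ' - κ)]
  exact sub_eq_zero.mp (norm_eq_zero.mp h4)

section G
variable {A K H : Type} [CStarAlgebra A] [PartialOrder A] [StarOrderedRing A]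
  [NormedAddCommGroup K] [InnerProductSpace ℂ K] [CompleteSpace K]
  [NormedAddCommGroup H] [InnerProductSpace ℂ H] [CompleteSpace H]
  (S : TrRep A K) (V : VN A H)

lemma exists_fixed (hN : V.Nrm S.t) (h1 : S.Λ 1 ≠ 0) (D : Set A) (C : ℝ) (hC : ∀ x ∈ D, ‖x‖ ≤ C)
    (hne : D.Nonempty) (hc : Convex ℝ D) :
    ∃ a : A, S.Λ a ∈ closure (S.Λ '' D) ∧
      ∀ p q : A, p ∈ unitary A → q ∈ unitary A → (∀ x ∈ D, p * x * q ∈ D) → p * a * q = a := by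
  have hc' : Convex ℝ (S.Λ '' D) := hc.linear_image (S.Λ.restrictScalars ℝ)
  obtain ⟨κ, hκ, hmin⟩ := exists_min' (S.Λ '' D) (hne.image _) hc'
  obtain ⟨a, -, ha⟩ := complete_closure S V hN hC hκ
  refine ⟨a, ha ▸ hκ, fun p q hp hq hpq => ?_⟩
  have hnorm : ∀ x, ‖S.Λ (p * x * q)‖ = ‖S.Λ x‖ := fun x => by
    rw [S.norm_unitary_right hq, S.norm_unitary_left hp]
  have hmem : S.Λ (p * a * q) ∈ closure (S.Λ '' D) := by
    rw [Metric.mem_closure_iff]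
    intro ε hε
    obtain ⟨_, ⟨x, hx, rfl⟩, hd⟩ := Metric.mem_closure_iff.mp hκ ε hε
    refine ⟨_, ⟨p * x * q, hpq x hx, rfl⟩, ?_⟩
    rw [dist_eq_norm, ← map_sub, ← sub_mul, ← mul_sub, hnorm, map_sub, ha, ← dist_eq_norm]
    exact hd
  have := hmin _ hmem (by rw [hnorm, ha])
  rw [← ha, ← sub_eq_zero, ← map_sub] at this
  exact sub_eq_zero.mp (normal_faithful S V hN h1 _ this)

lemma step2 (hN : V.Nrm S.t) (h1 : S.Λ 1 ≠ 0) (θ : A →⋆ₐ[ℂ] A) (P : StarSubalgebra ℂ A)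
    [hP : IsClosed (P : Set A)]
    (h : ∀ v ∈ P, v ∈ unitary A → ‖S.Λ (θ v - v)‖ ≤ ‖S.Λ 1‖ / 2) :
    ∃ a : A, a ≠ 0 ∧ ∀ x ∈ P, θ x * a = a * x := by
  have hL : 0 < ‖S.Λ 1‖ := norm_pos_iff.mpr h1
  set δ : ℝ := ‖S.Λ 1‖ ^ 2 / 2 with hδ
  have hθu : ∀ v ∈ unitary A, θ v ∈ unitary A := fun v hv => by
    rw [Unitary.mem_iff] at hv ⊢
    rw [← map_star, ← map_mul, ← map_mul, hv.1, hv.2, map_one]; simp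
  have hnu : ∀ v ∈ unitary A, ‖v‖ ≤ 1 := fun v hv => by
    have := CStarRing.norm_star_mul_self (x := v)
    rw [Unitary.star_mul_self_of_mem hv] at this
    have := norm_one_le_one A
    nlinarith [norm_nonneg v]
  let D : Set A := {x | ‖x‖ ≤ 1 ∧ ∀ v ∈ P, v ∈ unitary A → δ ≤ (S.t (θ v * x * star v)).re}
  have h1D : (1 : A) ∈ D := by
    refine ⟨norm_one_le_one A, fun v hv hu => ?_⟩
    have e : θ v * 1 * star v = 1 + star v * (θ v - v) + (θ v * star v - star v * θ v) := by
      rw [mul_sub, Unitary.star_mul_self_of_mem hu]; noncomm_ring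
    have e2 : S.t (θ v * 1 * star v) = S.t 1 + S.t (star v * (θ v - v)) := by
      rw [e, map_add, map_add, map_sub, S.tr (θ v), sub_self, add_zero]
    have b := S.t_star_mul_le v (θ v - v)
    have b2 := h v hv hu
    have b3 : ‖S.Λ v‖ = ‖S.Λ 1‖ := by simpa using S.norm_unitary_left hu 1
    have b4 := S.norm_sq 1
    rw [star_one, one_mul] at b4
    have b5 := Complex.abs_re_le_norm (S.t (star v * (θ v - v)))
    rw [b3] at b
    rw [e2, Complex.add_re, ← b4]
    have b6 := neg_abs_le (S.t (star v * (θ v - v))).re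
    nlinarith
  have hDc : Convex ℝ D := by
    intro x hx y hy a b ha hb hab
    refine ⟨?_, fun v hv hu => ?_⟩
    · have := convex_closedBall (0 : A) 1 (mem_closedBall_zero_iff.mpr hx.1) (mem_closedBall_zero_iff.mpr hy.1) ha hb hab
      exact mem_closedBall_zero_iff.mp this
    · have q1 := hx.2 v hv hu
      have q2 := hy.2 v hv hu
      rw [mul_add, add_mul, map_add, mul_smul_comm, smul_mul_assoc, mul_smul_comm, smul_mul_assoc,
        ← Complex.coe_smul, ← Complex.coe_smul, map_smul, map_smul, Complex.add_re, smul_eq_mul, smul_eq_mul,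
        Complex.re_ofReal_mul, Complex.re_ofReal_mul]
      have : δ = a * δ + b * δ := by rw [← add_mul, hab, one_mul]
      rw [this]; gcongr
  obtain ⟨a, ha, hfix⟩ := exists_fixed S V hN h1 D 1 (fun x hx => hx.1) ⟨1, h1D⟩ hDc
  refine ⟨a, ?_, ?_⟩
  · rintro rfl
    have hcl : IsClosed {k : K | δ ≤ (inner ℂ (S.Λ 1) k).re} :=
      isClosed_le continuous_const (by fun_prop)
    have : S.Λ 0 ∈ {k : K | δ ≤ (inner ℂ (S.Λ 1) k).re} := by
      refine hcl.closure_subset_iff.mpr ?_ ha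
      rintro _ ⟨x, hx, rfl⟩
      have := hx.2 1 P.one_mem (one_mem _)
      rw [map_one, one_mul, star_one, mul_one, S.t_eq] at this
      exact this
    simp at this
    have : 0 < δ := by positivity
    linarith
  · have hv : ∀ v ∈ P, v ∈ unitary A → θ v * a = a * v := by
      intro v hv hu
      have := hfix (θ v) (star v) (hθu v hu) (Unitary.star_mem hu) (by
        intro x hx
        refine ⟨?_, fun v' hv' hu' => ?_⟩
        · have n1 := hnu _ (hθu v hu)
          have n2 := hnu _ (Unitary.star_mem hu)
          have n3 := hx.1
          calc _ ≤ ‖θ v‖ * ‖x‖ * ‖star v‖ := by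
                refine (norm_mul_le _ _).trans ?_
                gcongr
                exact norm_mul_le _ _
            _ ≤ 1 * 1 * 1 := by gcongr
            _ = 1 := by norm_num
        · have := hx.2 (v' * v) (P.mul_mem hv' hv) (mul_mem hu' hu)
          rw [map_mul θ, star_mul] at this
          simpa only [mul_assoc] using this)
      conv_rhs => rw [← this]
      rw [mul_assoc, Unitary.star_mul_self_of_mem hu, mul_one]
    have := of_unitary (A := P)
      (((LinearMap.mulRight ℂ a).comp θ.toAlgHom.toLinearMap).comp P.subtype.toAlgHom.toLinearMap)
      ((LinearMap.mulLeft ℂ a).comp P.subtype.toAlgHom.toLinearMap) (by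
        intro u hu
        refine hv u u.2 ?_
        rw [Unitary.mem_iff] at hu ⊢
        exact ⟨congrArg Subtype.val hu.1, congrArg Subtype.val hu.2⟩)
    intro x hx
    exact congrArg (fun f => f ⟨x, hx⟩) this

lemma step4 (hN : V.Nrm S.t) (h1 : S.Λ 1 ≠ 0) (θ : A →⋆ₐ[ℂ] A) (p c : A) (hps : star p = p)
    (hp2 : p * p = p) (hc0 : c ≠ 0) (hcp : c * p = c) (hpc : θ p * c = c)
    (hx : ∀ x, θ (p * x * p) * c = c * (p * x * p)) :
    ∃ b : A, b ≠ 0 ∧ ∀ x, θ x * b = b * x := by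
  have hL : 0 < ‖S.Λ 1‖ := norm_pos_iff.mpr h1
  have hf := normal_faithful S V hN h1
  have hθu : ∀ v ∈ unitary A, θ v ∈ unitary A := fun v hv => by
    rw [Unitary.mem_iff] at hv ⊢
    rw [← map_star, ← map_mul, ← map_mul, hv.1, hv.2, map_one]; simp
  have hnu : ∀ v ∈ unitary A, ‖v‖ ≤ 1 := fun v hv => by
    have := CStarRing.norm_star_mul_self (x := v)
    rw [Unitary.star_mul_self_of_mem hv] at this
    have := norm_one_le_one A
    nlinarith [norm_nonneg v]
  set h := star c * c with hh
  have hpcs : p * star c = star c := by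
    have := congrArg star hcp
    rwa [star_mul, hps] at this
  have hcpc : star c * θ p = star c := by
    have := congrArg star hpc
    rwa [star_mul, ← map_star, hps] at this
  have hkey : ∀ r, star c * θ r * c = h * r * p := by
    intro r
    calc star c * θ r * c = (star c * θ p) * θ r * (θ p * c) := by rw [hcpc, hpc]
      _ = star c * (θ (p * r * p) * c) := by rw [map_mul, map_mul]; simp only [mul_assoc]
      _ = star c * ((c * p) * r * p) := by rw [hx]; simp only [mul_assoc]
      _ = _ := by rw [hcp, hh]; simp only [mul_assoc]
  have hh0 : 0 ≤ h := star_mul_self_nonneg c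
  have hhp : h ≤ ‖h‖ • p := by
    have e0 : h ≤ algebraMap ℝ A ‖h‖ := IsSelfAdjoint.le_algebraMap_norm_self (IsSelfAdjoint.of_nonneg hh0)
    have := star_left_conjugate_le_conjugate e0 p
    have e1 : star p * h * p = h := by
      rw [hps, hh, ← mul_assoc, hpcs, mul_assoc, hcp]
    have e2 : star p * algebraMap ℝ A ‖h‖ * p = ‖h‖ • p := by
      rw [hps, Algebra.algebraMap_eq_smul_one]; simp [hp2]
    rwa [e1, e2] at this
  have hp0 : 0 ≤ p := by rw [← hp2]; nth_rewrite 1 [← hps]; exact star_mul_self_nonneg p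
  let G : Set (A × A × A) := {z | ∃ w ∈ unitary A, z = (θ w * c * star w, w * h * star w, w * p * star w)}
  let D3 : Set (A × A × A) := convexHull ℝ G
  -- linear properties
  have lin1 : ∀ z ∈ D3, 0 ≤ z.2.1 ∧ z.2.1 ≤ ‖h‖ • z.2.2 ∧ (S.t z.2.1).re = (S.t h).re ∧ ‖z.1‖ ≤ ‖c‖ := by
    let Q : Set (A × A × A) := {z | 0 ≤ z.2.1 ∧ z.2.1 ≤ ‖h‖ • z.2.2 ∧ (S.t z.2.1).re = (S.t h).re ∧ ‖z.1‖ ≤ ‖c‖}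
    have : D3 ⊆ Q := by
      refine convexHull_min ?_ ?_
      · rintro _ ⟨w, hw, rfl⟩
        refine ⟨star_right_conjugate_nonneg hh0 w, ?_, ?_, ?_⟩
        · have := star_right_conjugate_le_conjugate hhp w
          simpa using this
        · change (S.t (w * h * star w)).re = _
          rw [mul_assoc, S.tr, mul_assoc, Unitary.star_mul_self_of_mem hw, mul_one]
        · have n1 := hnu _ (hθu w hw)
          have n2 := hnu _ (Unitary.star_mem hw)
          calc ‖θ w * c * star w‖ ≤ ‖θ w‖ * ‖c‖ * ‖star w‖ := by
                refine (norm_mul_le _ _).trans ?_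
                gcongr
                exact norm_mul_le _ _
            _ ≤ 1 * ‖c‖ * 1 := by gcongr
            _ = ‖c‖ := by ring
      · intro x hx y hy a b ha hb hab
        refine ⟨?_, ?_, ?_, ?_⟩
        · exact add_nonneg (smul_nonneg ha hx.1) (smul_nonneg hb hy.1)
        · have q1 := smul_le_smul_of_nonneg_left hx.2.1 ha
          have q2 := smul_le_smul_of_nonneg_left hy.2.1 hb
          refine (add_le_add q1 q2).trans (le_of_eq ?_)
          change a • (‖h‖ • x.2.2) + b • (‖h‖ • y.2.2) = ‖h‖ • (a • x.2.2 + b • y.2.2)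
          rw [smul_add, smul_comm a, smul_comm b]
        · change (S.t (a • x.2.1 + b • y.2.1)).re = _
          rw [← Complex.coe_smul, ← Complex.coe_smul, map_add, map_smul, map_smul, Complex.add_re, smul_eq_mul, smul_eq_mul,
            Complex.re_ofReal_mul, Complex.re_ofReal_mul, hx.2.2.1, hy.2.2.1, ← add_mul, hab, one_mul]
        · have := convex_closedBall (0 : A) ‖c‖ (mem_closedBall_zero_iff.mpr hx.2.2.2) (mem_closedBall_zero_iff.mpr hy.2.2.2) ha hb hab
          exact mem_closedBall_zero_iff.mp this
    exact fun z hz => this hz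
  have lin2 : ∀ z ∈ G, ∀ z' ∈ D3, S.t (star z.1 * z'.1) = S.t (z.2.1 * z'.2.2) := by
    rintro _ ⟨w, hw, rfl⟩
    let Q : Set (A × A × A) := {z' | S.t (star (θ w * c * star w) * z'.1) = S.t ((w * h * star w) * z'.2.2)}
    have : D3 ⊆ Q := by
      refine convexHull_min ?_ ?_
      · rintro _ ⟨w', hw', rfl⟩
        change S.t (star (θ w * c * star w) * (θ w' * c * star w')) = S.t ((w * h * star w) * (w' * p * star w'))
        have e : star (θ w * c * star w) * (θ w' * c * star w') = w * (star c * θ (star w * w') * c) * star w' := by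
          simp only [star_mul, star_star, map_mul, map_star, mul_assoc]
        rw [e, hkey]
        simp only [mul_assoc]
      · intro x hx y hy a b ha hb hab
        change S.t (star (θ w * c * star w) * (a • x.1 + b • y.1)) = S.t ((w * h * star w) * (a • x.2.2 + b • y.2.2))
        simp only [← Complex.coe_smul, mul_add, mul_smul_comm, map_add, map_smul]
        rw [show S.t (star (θ w * c * star w) * x.1) = _ from hx, show S.t (star (θ w * c * star w) * y.1) = _ from hy]
    exact fun z hz => this hz
  have lin3 : ∀ z ∈ D3, ∀ z' ∈ D3, S.t (star z.1 * z'.1) = S.t (z.2.1 * z'.2.2) := by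
    intro z hz z' hz'
    let Q : Set (A × A × A) := {z | S.t (star z.1 * z'.1) = S.t (z.2.1 * z'.2.2)}
    have : D3 ⊆ Q := by
      refine convexHull_min (fun z hz => lin2 z hz z' hz') ?_
      intro x hx y hy a b ha hb hab
      change S.t (star (a • x.1 + b • y.1) * z'.1) = S.t ((a • x.2.1 + b • y.2.1) * z'.2.2)
      rw [star_add, star_smul, star_smul, star_trivial a, star_trivial b]
      simp only [← Complex.coe_smul, add_mul, smul_mul_assoc, map_add, map_smul]
      rw [show S.t (star x.1 * z'.1) = _ from hx, show S.t (star y.1 * z'.1) = _ from hy]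
    exact this hz
  have hcΛ : 0 < ‖S.Λ c‖ := norm_pos_iff.mpr fun h0 => hc0 (hf c h0)
  have hlow : ∀ z ∈ D3, (‖S.Λ c‖ ^ 2) ^ 2 ≤ ‖S.Λ z.1‖ ^ 2 * (‖h‖ * ‖S.Λ 1‖ ^ 2) := by
    intro z hz
    obtain ⟨z0, z1, z2, -⟩ := lin1 z hz
    have e1 : ‖S.Λ z.1‖ ^ 2 = (S.t (z.2.1 * z.2.2)).re := by rw [S.norm_sq, lin3 z hz z hz]
    have e2 := S.t_mul_nonneg z0 (sub_nonneg.mpr z1)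
    rw [mul_sub, map_sub, Complex.sub_re, mul_smul_comm, ← Complex.coe_smul, map_smul, smul_eq_mul, Complex.re_ofReal_mul,
      ← e1] at e2
    have hs : star z.2.1 = z.2.1 := IsSelfAdjoint.of_nonneg z0
    have e3 : ‖S.Λ z.2.1‖ ^ 2 = (S.t (z.2.1 * z.2.1)).re := by rw [S.norm_sq, hs]
    have e4 : (S.t z.2.1).re ≤ ‖S.Λ 1‖ * ‖S.Λ z.2.1‖ := by
      have := S.t_star_mul_le 1 z.2.1
      rw [star_one, one_mul] at this
      exact (Complex.re_le_norm _).trans this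
    rw [z2, hh, ← S.norm_sq] at e4
    calc (‖S.Λ c‖ ^ 2) ^ 2 ≤ (‖S.Λ 1‖ * ‖S.Λ z.2.1‖) ^ 2 := by gcongr
      _ = ‖S.Λ 1‖ ^ 2 * ‖S.Λ z.2.1‖ ^ 2 := by ring
      _ ≤ ‖S.Λ 1‖ ^ 2 * (‖h‖ * ‖S.Λ z.1‖ ^ 2) := by rw [e3]; gcongr; linarith
      _ = _ := by ring
  let D : Set A := Prod.fst '' D3
  have hDne : D.Nonempty := ⟨_, _, subset_convexHull ℝ G ⟨1, one_mem _, rfl⟩, rfl⟩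
  have hDc : Convex ℝ D := (convex_convexHull ℝ G).linear_image (LinearMap.fst ℝ A (A × A))
  obtain ⟨b, hb, hfix⟩ := exists_fixed S V hN h1 D ‖c‖ (by rintro _ ⟨z, hz, rfl⟩; exact (lin1 z hz).2.2.2) hDne hDc
  refine ⟨b, ?_, ?_⟩
  · rintro rfl
    have hcl : IsClosed {k : K | (‖S.Λ c‖ ^ 2) ^ 2 ≤ ‖k‖ ^ 2 * (‖h‖ * ‖S.Λ 1‖ ^ 2)} :=
      isClosed_le continuous_const (by fun_prop)
    have : S.Λ 0 ∈ {k : K | (‖S.Λ c‖ ^ 2) ^ 2 ≤ ‖k‖ ^ 2 * (‖h‖ * ‖S.Λ 1‖ ^ 2)} := by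
      refine hcl.closure_subset_iff.mpr ?_ hb
      rintro _ ⟨_, ⟨z, hz, rfl⟩, rfl⟩
      exact hlow z hz
    simp only [map_zero, Set.mem_setOf_eq, norm_zero] at this
    have h4 : 0 < (‖S.Λ c‖ ^ 2) ^ 2 := by positivity
    norm_num at this
    exact hcΛ.ne' (norm_eq_zero.mpr this)
  · have hv : ∀ v ∈ unitary A, θ v * b = b * v := by
      intro v hu
      have := hfix (θ v) (star v) (hθu v hu) (Unitary.star_mem hu) (by
        rintro _ ⟨z, hz, rfl⟩
        let Q : Set (A × A × A) := {z | θ v * z.1 * star v ∈ D}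
        have : D3 ⊆ Q := by
          refine convexHull_min ?_ ?_
          · rintro _ ⟨w, hw, rfl⟩
            refine ⟨_, subset_convexHull ℝ G ⟨v * w, mul_mem hu hw, rfl⟩, ?_⟩
            simp only [map_mul, star_mul, mul_assoc]
          · intro x hx y hy a b ha hb hab
            have := hDc hx hy ha hb hab
            change θ v * (a • x.1 + b • y.1) * star v ∈ D
            convert this using 1
            simp only [mul_add, add_mul, mul_smul_comm, smul_mul_assoc]
        exact this hz)
      conv_rhs => rw [← this]
      rw [mul_assoc, Unitary.star_mul_self_of_mem hu, mul_one]
    have := of_unitary ((LinearMap.mulRight ℂ b).comp θ.toAlgHom.toLinearMap) (LinearMap.mulLeft ℂ b) hv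
    intro x
    exact congrArg (fun f => f x) this

lemma step5 {A K H : Type} [CStarAlgebra A] [PartialOrder A] [StarOrderedRing A]
  [NormedAddCommGroup K] [InnerProductSpace ℂ K] [CompleteSpace K]
  [NormedAddCommGroup H] [InnerProductSpace ℂ H] [CompleteSpace H]
  (S : TrRep A K) (V : VN A H) (h1 : S.Λ 1 ≠ 0) (θ : A →⋆ₐ[ℂ] A) (hθ : Function.Surjective θ) (b : A) (hb : b ≠ 0)
    (hx : ∀ x, θ x * b = b * x) : ∃ w ∈ unitary A, ∀ x, θ x = w * x * star w := by
  have hL : 0 < ‖S.Λ 1‖ := norm_pos_iff.mpr h1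
  have hxs : ∀ x, star b * θ x = x * star b := by
    intro x
    have := congrArg star (hx (star x))
    rwa [star_mul, star_mul, ← map_star, star_star] at this
  obtain ⟨μ, hμ⟩ := V.factor (star b * b) fun y => by
    rw [mul_assoc, ← hx, ← mul_assoc, hxs, mul_assoc]
  obtain ⟨ν, hν⟩ := V.factor (b * star b) fun y => by
    obtain ⟨x, rfl⟩ := hθ y
    rw [mul_assoc, hxs, ← mul_assoc, ← hx, mul_assoc]
  have hμν : μ = ν := by
    have : μ • b = ν • b := by
      calc μ • b = b * (μ • 1) := by simp
        _ = (b * star b) * b := by rw [← hμ, mul_assoc]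
        _ = ν • b := by rw [hν]; simp
    rw [← sub_eq_zero, ← sub_smul] at this
    exact sub_eq_zero.mp ((smul_eq_zero.mp this).resolve_right hb)
  have hμr : μ = ((‖S.Λ b‖ ^ 2 / ‖S.Λ 1‖ ^ 2 : ℝ) : ℂ) := by
    have e1 : S.t (star b * b) = ((‖S.Λ b‖ ^ 2 : ℝ) : ℂ) := by
      rw [← S.inner_eq, inner_self_eq_norm_sq_to_K]; norm_cast
    have e2 : S.t 1 = ((‖S.Λ 1‖ ^ 2 : ℝ) : ℂ) := by
      have := S.inner_eq 1 1
      rw [star_one, one_mul] at this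
      rw [← this, inner_self_eq_norm_sq_to_K]; norm_cast
    rw [hμ, map_smul, e2, smul_eq_mul] at e1
    rw [Complex.ofReal_div, ← e1, mul_div_cancel_right₀]
    exact_mod_cast (by positivity : ‖S.Λ 1‖ ^ 2 ≠ 0)
  set m : ℝ := ‖S.Λ b‖ ^ 2 / ‖S.Λ 1‖ ^ 2
  have hm0 : 0 ≤ m := by positivity
  have hmne : m ≠ 0 := by
    intro h0
    rw [h0] at hμr
    rw [hμr, Complex.ofReal_zero, zero_smul] at hμ
    exact hb (CStarRing.star_mul_self_eq_zero_iff b |>.mp hμ)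
  have hm : 0 < m := lt_of_le_of_ne hm0 (Ne.symm hmne)
  set s : ℝ := (Real.sqrt m)⁻¹
  have hs : s * s * m = 1 := by
    have : Real.sqrt m * Real.sqrt m = m := Real.mul_self_sqrt hm0
    have h2 : 0 < Real.sqrt m := Real.sqrt_pos.mpr hm
    simp only [s]
    nth_rewrite 3 [← this]
    field_simp
  have hμ' : star b * b = m • (1 : A) := by rw [hμ, hμr, Complex.coe_smul]
  have hν' : b * star b = m • (1 : A) := by rw [hν, ← hμν, hμr, Complex.coe_smul]
  have hw : s • b ∈ unitary A := by
    rw [Unitary.mem_iff]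
    constructor
    · rw [star_smul, star_trivial, smul_mul_smul_comm, hμ', smul_smul, hs, one_smul]
    · rw [star_smul, star_trivial, smul_mul_smul_comm, hν', smul_smul, hs, one_smul]
  refine ⟨s • b, hw, fun x => ?_⟩
  have : s • b * x = θ x * (s • b) := by rw [smul_mul_assoc, ← hx, mul_smul_comm]
  rw [this, mul_assoc, Unitary.mul_star_self_of_mem hw, mul_one]
end G
end CDP

end

noncomputable section
open scoped Classical ComplexOrder InnerProductSpace
open Filter Topology
namespace CDP

lemma spec_finite {B : Type} [CStarAlgebra B] [FiniteDimensional ℂ B] (h : B) :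
    (spectrum ℝ h).Finite := by
  have : FiniteDimensional ℝ B := FiniteDimensional.complexToReal B
  have hi : IsIntegral ℝ h := Algebra.IsIntegral.isIntegral h
  refine (minpoly ℝ h).roots.toFinset.finite_toSet.subset ?_
  intro l hl
  have h1 := spectrum.subset_polynomial_aeval h (minpoly ℝ h) ⟨l, hl, rfl⟩
  have : Nontrivial B := by
    by_contra hn
    rw [not_nontrivial_iff_subsingleton] at hn
    rw [spectrum.of_subsingleton] at hl
    exact hl
  rw [minpoly.aeval, spectrum.zero_eq] at h1
  simp only [Multiset.mem_toFinset, Finset.mem_coe]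
  exact (Polynomial.mem_roots (minpoly.ne_zero hi)).mpr h1

lemma spec_proj {B : Type} [CStarAlgebra B] [FiniteDimensional ℂ B] (h : B) (hs : IsSelfAdjoint h)
    (h0 : h ≠ 0) : ∃ q : B, star q = q ∧ q * q = q ∧ q ≠ 0 ∧
      ∃ l : ℝ, l ≠ 0 ∧ h * q = l • q ∧ q * h = l • q := by
  have hfin := spec_finite h
  have hc : ∀ f : ℝ → ℝ, ContinuousOn f (spectrum ℝ h) := fun f => hfin.continuousOn f
  obtain ⟨l, hl, hl0⟩ : ∃ l ∈ spectrum ℝ h, l ≠ 0 := by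
    by_contra hn
    push Not at hn
    exact h0 (CFC.eq_zero_of_spectrum_subset_zero (R := ℝ) h (fun l hl => hn l hl) hs)
  have : Nontrivial B := ⟨h, 0, h0⟩
  let f : ℝ → ℝ := fun x => if x = l then 1 else 0
  refine ⟨cfc f h, ?_, ?_, ?_, l, hl0, ?_, ?_⟩
  · exact IsSelfAdjoint.cfc
  · rw [← cfc_mul f f h (hc _) (hc _)]
    congr 1
    ext x
    simp only [f]; split_ifs <;> simp
  · intro hq
    have := cfc_map_spectrum (R := ℝ) f h hs (hc f)
    rw [hq, spectrum.zero_eq] at this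
    have h2 : f l ∈ ({0} : Set ℝ) := this ▸ ⟨l, hl, rfl⟩
    simp [f] at h2
  · conv_lhs => rw [← cfc_id' ℝ h hs]
    rw [cfc_id' ℝ h hs]
    nth_rewrite 1 [← cfc_id' ℝ h hs]
    rw [← cfc_mul _ f h (hc _) (hc _), ← cfc_smul l f h (hc _)]
    congr 1
    ext x
    simp only [f]; split_ifs with hx <;> simp [hx]
  · nth_rewrite 2 [← cfc_id' ℝ h hs]
    rw [← cfc_mul f _ h (hc _) (hc _), ← cfc_smul l f h (hc _)]
    congr 1
    ext x
    simp only [f]; split_ifs with hx <;> simp [hx]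

lemma min_proj_aux {B : Type} [CStarAlgebra B] [FiniteDimensional ℂ B] (E : Set B)
    (hne : ∃ q, star q = q ∧ q * q = q ∧ q ∈ E) 
    (hE0 : (0 : B) ∉ E) (hadd : ∀ x y, x + y ∈ E → x ∈ E ∨ y ∈ E) :
    ∃ p, star p = p ∧ p * p = p ∧ p ∈ E ∧ ∀ x, ∃ c : ℂ, p * x * p = c • p := by
  let L : B → (B →ₗ[ℂ] B) := fun q => (LinearMap.mulLeft ℂ q).comp (LinearMap.mulRight ℂ q)
  let T : Set B := {q | star q = q ∧ q * q = q ∧ q ∈ E}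
  have hT : T.Nonempty := hne
  let p := Function.argminOn (fun q => Module.finrank ℂ (LinearMap.range (L q))) T hT
  have hp : p ∈ T := Function.argminOn_mem _ _ _
  have hmin : ∀ q ∈ T, Module.finrank ℂ (LinearMap.range (L p)) ≤ Module.finrank ℂ (LinearMap.range (L q)) :=
    fun q hq => Function.argminOn_le (fun q => Module.finrank ℂ (LinearMap.range (L q))) T hq
  obtain ⟨hps, hp2, hpE⟩ := hp
  have hle : ∀ e, e ∈ T → e * p = e → p * e = e → e = p := by
    intro e he h1 h2
    have hsub : LinearMap.range (L e) ≤ LinearMap.range (L p) := by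
      rintro _ ⟨x, rfl⟩
      refine ⟨e * (x * e), ?_⟩
      change p * (e * (x * e) * p) = e * (x * e)
      rw [mul_assoc e, mul_assoc x, h1, ← mul_assoc, h2]
    have heq := Submodule.eq_of_le_of_finrank_le hsub (hmin e he)
    have : p ∈ LinearMap.range (L e) := by
      rw [heq]; refine ⟨1, ?_⟩
      change p * (1 * p) = p
      rw [one_mul, hp2]
    obtain ⟨x, hx⟩ := this
    change e * (x * e) = p at hx
    rw [← h1, ← hx, ← mul_assoc, he.2.1]
  have hmi : ∀ e, star e = e → e * e = e → e * p = e → p * e = e → e ≠ 0 → e = p := by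
    intro e hes he2 h1 h2 he0
    rcases hadd e (p - e) (by rwa [add_sub_cancel]) with h | h
    · exact hle e ⟨hes, he2, h⟩ h1 h2
    · have := hle (p - e) ⟨by rw [star_sub, hps, hes], by
        rw [sub_mul, mul_sub, mul_sub, hp2, h1, h2, he2]; abel, h⟩
        (by rw [sub_mul, hp2, h1]) (by rw [mul_sub, hp2, h2])
      exact absurd (sub_eq_self.mp this) he0
  have hsa : ∀ x, IsSelfAdjoint x → ∃ c : ℝ, p * x * p = c • p := by
    intro x hx
    by_cases h0 : p * x * p = 0
    · exact ⟨0, by rw [h0, zero_smul]⟩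
    have hxs : IsSelfAdjoint (p * x * p) := by
      have := hx.conjugate p
      rwa [hps] at this
    obtain ⟨q, hqs, hq2, hq0, l, hl, h1, h2⟩ := spec_proj _ hxs h0
    have e1 : q = l⁻¹ • (p * x * p * q) := by rw [h1, smul_smul, inv_mul_cancel₀ hl, one_smul]
    have e2 : q = l⁻¹ • (q * (p * x * p)) := by rw [h2, smul_smul, inv_mul_cancel₀ hl, one_smul]
    have hqp : q = p := by
      refine hmi q hqs hq2 ?_ ?_ hq0
      · conv_lhs => rw [e2]
        conv_rhs => rw [e2]
        rw [smul_mul_assoc]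
        simp only [mul_assoc, hp2]
      · conv_lhs => rw [e1]
        conv_rhs => rw [e1]
        rw [mul_smul_comm]
        simp only [← mul_assoc, hp2]
    refine ⟨l, ?_⟩
    rw [hqp] at h1
    rw [← h1, mul_assoc _ p p, hp2]
  refine ⟨p, hps, hp2, hpE, fun x => ?_⟩
  obtain ⟨c, hc⟩ := hsa _ (realPart x).2
  obtain ⟨d, hd⟩ := hsa _ (imaginaryPart x).2
  refine ⟨c + Complex.I * d, ?_⟩
  conv_lhs => rw [← realPart_add_I_smul_imaginaryPart x]
  rw [mul_add, add_mul, hc, mul_smul_comm, smul_mul_assoc, hd, add_smul, mul_smul, Complex.coe_smul, Complex.coe_smul]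

lemma min_proj {A : Type} [CStarAlgebra A] (N : StarSubalgebra ℂ A) [FiniteDimensional ℂ N]
    (a : A) (ha : a ≠ 0) : ∃ p ∈ N, star p = p ∧ p * p = p ∧ a * p ≠ 0 ∧
      ∀ x ∈ N, ∃ c : ℂ, p * x * p = c • p := by
  have hcl : IsClosed (N : Set A) :=
    Submodule.closed_of_finiteDimensional (Subalgebra.toSubmodule N.toSubalgebra)
  obtain ⟨p, h1, h2, h3, h4⟩ := min_proj_aux (B := N) {q | a * (q : A) ≠ 0} ⟨1, by simp, by simp, by simpa using ha⟩
    (by simp) (by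
      intro x y hxy
      by_contra hn
      push Not at hn
      simp only [Set.mem_setOf_eq, not_not, ne_eq] at hn hxy
      apply hxy
      push_cast
      rw [mul_add, hn.1, hn.2, add_zero])
  refine ⟨p, p.2, congrArg Subtype.val h1, congrArg Subtype.val h2, h3, fun x hx => ?_⟩
  obtain ⟨c, hc⟩ := h4 ⟨x, hx⟩
  exact ⟨c, congrArg Subtype.val hc⟩

section H
variable {A K H : Type} [CStarAlgebra A] [PartialOrder A] [StarOrderedRing A]
  [NormedAddCommGroup K] [InnerProductSpace ℂ K] [CompleteSpace K]
  [NormedAddCommGroup H] [InnerProductSpace ℂ H] [CompleteSpace H]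
  (S : TrRep A K) (V : VN A H)

lemma exists_onb (hf : ∀ x, S.Λ x = 0 → x = 0) (N : StarSubalgebra ℂ A) [hfd : FiniteDimensional ℂ N] :
    ∃ (n : ℕ) (v : Fin n → A), (∀ k, v k ∈ N) ∧ ∀ y ∈ N, y = ∑ k, S.t (star (v k) * y) • v k := by
  let N' : Submodule ℂ A := Subalgebra.toSubmodule N.toSubalgebra
  have : FiniteDimensional ℂ N' := hfd
  let E : Submodule ℂ K := N'.map S.Λ
  have : FiniteDimensional ℂ E := inferInstance
  let b := stdOrthonormalBasis ℂ E
  have hb : ∀ k, ∃ v ∈ N, S.Λ v = b k := fun k => (b k).2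
  choose v hv hvb using hb
  refine ⟨_, v, hv, fun y hy => ?_⟩
  have h1 := b.sum_repr' ⟨S.Λ y, y, hy, rfl⟩
  have h2 := congrArg Subtype.val h1
  rw [← sub_eq_zero]
  apply hf
  rw [map_sub, sub_eq_zero, map_sum]
  rw [Submodule.coe_sum] at h2
  refine h2.symm.trans (Finset.sum_congr rfl fun k _ => ?_)
  rw [map_smul, ← S.inner_eq, hvb]
  rfl

lemma step3 (hf : ∀ x, S.Λ x = 0 → x = 0) (θ : A →⋆ₐ[ℂ] A) (N : StarSubalgebra ℂ A)
    [FiniteDimensional ℂ N] (a : A) (ha : a ≠ 0)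
    (hx : ∀ x, (∀ y ∈ N, x * y = y * x) → θ x * a = a * x) :
    ∃ p c : A, star p = p ∧ p * p = p ∧ c ≠ 0 ∧ c * p = c ∧ θ p * c = c ∧
      ∀ x, θ (p * x * p) * c = c * (p * x * p) := by
  obtain ⟨p, hpN, hps, hp2, hap, hmin⟩ := min_proj N a ha
  obtain ⟨n, v, hv, hexp⟩ := exists_onb S hf N
  have hconj : ∀ x y : A, starRingEnd ℂ (S.t (star x * y)) = S.t (star y * x) := fun x y => by
    rw [← S.inner_eq, ← S.inner_eq, inner_conj_symm]
  let T : A → A := fun x => ∑ k, v k * x * star (v k)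
  have hT : ∀ x, ∀ y ∈ N, T x * y = y * T x := by
    intro x y hy
    have e1 : ∀ k, y * v k = ∑ j, S.t (star (v j) * (y * v k)) • v j :=
      fun k => hexp _ (N.mul_mem hy (hv k))
    have e2 : ∀ k, star (v k) * y = ∑ j, S.t (star (v k) * (y * v j)) • star (v j) := by
      intro k
      have := congrArg star (hexp _ (mul_mem (s := N) (star_mem hy) (hv k)))
      rw [star_mul, star_star, star_sum] at this
      rw [this]
      refine Finset.sum_congr rfl fun j _ => ?_
      rw [star_smul]
      congr 1
      have := hconj (v j) (star y * v k)
      rw [star_mul, star_star, mul_assoc] at this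
      exact this
    have l : T x * y = ∑ k, ∑ j, S.t (star (v k) * (y * v j)) • (v k * x * star (v j)) := by
      simp only [T, Finset.sum_mul]
      refine Finset.sum_congr rfl fun k _ => ?_
      rw [mul_assoc, e2, Finset.mul_sum]
      simp only [mul_smul_comm]
    have r : y * T x = ∑ k, ∑ j, S.t (star (v j) * (y * v k)) • (v j * x * star (v k)) := by
      simp only [T, Finset.mul_sum]
      refine Finset.sum_congr rfl fun k _ => ?_
      rw [← mul_assoc, ← mul_assoc]
      conv_lhs => rw [e1, Finset.sum_mul, Finset.sum_mul]
      simp only [smul_mul_assoc]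
    rw [l, r, Finset.sum_comm]
  choose c hc using fun k => hmin (v k) (hv k)
  let s : ℝ := ∑ k, ‖c k‖ ^ 2
  have hTp : ∀ x, p * x = x → x * p = x → T x * p = (s : ℂ) • x := by
    intro x h1 h2
    have : T x * p = p * T x * p := by rw [← hT x p hpN, mul_assoc, hp2]
    rw [this]
    simp only [T, s, Finset.mul_sum, Finset.sum_mul, Complex.ofReal_sum, Finset.sum_smul]
    refine Finset.sum_congr rfl fun k _ => ?_
    have hcs : p * star (v k) * p = starRingEnd ℂ (c k) • p := by
      have := congrArg star (hc k)
      rw [star_mul, star_mul, star_smul, hps] at this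
      rw [mul_assoc]; exact this
    calc p * (v k * x * star (v k)) * p = p * v k * (p * x * p) * star (v k) * p := by
          rw [h1, h2]; simp only [mul_assoc]
      _ = (p * v k * p) * x * (p * star (v k) * p) := by simp only [mul_assoc]
      _ = (c k * starRingEnd ℂ (c k)) • (p * x * p) := by
          rw [hc, hcs, smul_mul_assoc, smul_mul_smul_comm]
      _ = _ := by rw [h1, h2, Complex.mul_conj, Complex.normSq_eq_norm_sq]
  have hp0 : p ≠ 0 := by rintro rfl; simp at hap
  have hs0 : (s : ℂ) ≠ 0 := by
    intro h0
    have h0 : s = 0 := by exact_mod_cast h0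
    have hck : ∀ k, c k = 0 := by
      intro k
      have := (Finset.sum_eq_zero_iff_of_nonneg (fun k _ => by positivity)).mp h0 k (Finset.mem_univ _)
      simpa using this
    apply hp0
    have e := hexp 1 N.one_mem
    calc p = p * 1 * p := by rw [mul_one, hp2]
      _ = 0 := by
        rw [e, Finset.mul_sum, Finset.sum_mul]
        refine Finset.sum_eq_zero fun k _ => ?_
        rw [mul_smul_comm, smul_mul_assoc, hc, hck]; simp
  have hTx := fun x => hx (T x) (hT x)
  obtain ⟨k, hk⟩ : ∃ k, θ (p * star (v k)) * a * p ≠ 0 := by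
    by_contra hn
    push Not at hn
    have e : θ (T p) * a * p = 0 := by
      simp only [T, map_sum, Finset.sum_mul]
      refine Finset.sum_eq_zero fun k _ => ?_
      rw [mul_assoc (v k), map_mul, mul_assoc, mul_assoc, ← mul_assoc (θ _) a p, hn, mul_zero]
    rw [hTx, mul_assoc, hTp p hp2 hp2, mul_smul_comm] at e
    exact (smul_eq_zero.mp e).elim hs0 hap
  refine ⟨p, θ (p * star (v k)) * a * p, hps, hp2, hk, ?_, ?_, ?_⟩
  · rw [mul_assoc, hp2]
  · rw [← mul_assoc, ← mul_assoc, ← map_mul, ← mul_assoc, hp2]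
  · intro x
    set y := p * x * p with hy
    have h1 : p * y = y := by rw [hy, ← mul_assoc, ← mul_assoc, hp2]
    have h2 : y * p = y := by rw [hy, mul_assoc, hp2]
    have hm : p * star (v k) ∈ N := mul_mem (s := N) hpN (star_mem (hv k))
    have e1 : (s : ℂ) • (θ y * (θ (p * star (v k)) * a * p)) = (s : ℂ) • (θ (p * star (v k)) * a * p * y) := by
      calc (s : ℂ) • (θ y * (θ (p * star (v k)) * a * p)) = θ ((s : ℂ) • y) * (θ (p * star (v k)) * a * p) := by
            rw [map_smul, smul_mul_assoc]
        _ = θ (T y * (p * star (v k))) * a * p := by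
            rw [← hTp y h1 h2, map_mul, ← mul_assoc, ← mul_assoc, mul_assoc (θ (T y)), ← map_mul, ← mul_assoc p p, hp2,
              map_mul θ (T y)]
        _ = θ (p * star (v k)) * (a * (T y * p)) := by
            rw [hT y _ hm, map_mul, mul_assoc, mul_assoc, ← mul_assoc (θ (T y)), hTx, mul_assoc]
        _ = _ := by
            rw [hTp y h1 h2, mul_smul_comm, mul_smul_comm, mul_assoc _ p y, h1, mul_assoc]
    exact smul_right_injective A hs0 e1

theorem inner_of_close (hN : V.Nrm S.t) (h1 : S.Λ 1 ≠ 0) (θ : A →⋆ₐ[ℂ] A)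
    (hθ : Function.Surjective θ) (N : StarSubalgebra ℂ A) [FiniteDimensional ℂ N]
    (h : ∀ v, (∀ y ∈ N, v * y = y * v) → v ∈ unitary A → ‖S.Λ (θ v - v)‖ ≤ ‖S.Λ 1‖ / 2) :
    ∃ w ∈ unitary A, ∀ x, θ x = w * x * star w := by
  let P : StarSubalgebra ℂ A := StarSubalgebra.centralizer ℂ (N : Set A)
  have hmem : ∀ x, x ∈ P ↔ ∀ y ∈ N, x * y = y * x := by
    intro x
    rw [StarSubalgebra.mem_centralizer_iff]
    constructor
    · exact fun h y hy => (h y hy).1.symm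
    · exact fun h y hy => ⟨(h y hy).symm, (h _ (star_mem hy)).symm⟩
  have hP : IsClosed (P : Set A) := by
    have : (P : Set A) = ⋂ y ∈ N, {x | x * y = y * x} := by
      ext x
      simp only [Set.mem_iInter]
      exact hmem x
    rw [this]
    refine isClosed_biInter fun y _ => isClosed_eq (by fun_prop) (by fun_prop)
  obtain ⟨a, ha, hax⟩ := step2 S V hN h1 θ P fun v hv hu => h v ((hmem v).mp hv) hu
  obtain ⟨p, c, hps, hp2, hc0, hcp, hpc, hx⟩ := step3 S (normal_faithful S V hN h1) θ N a ha
    fun x hx => hax x ((hmem x).mpr hx)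
  obtain ⟨b, hb, hbx⟩ := step4 S V hN h1 θ p c hps hp2 hc0 hcp hpc hx
  exact step5 S V h1 θ hθ b hb hbx
end H
end CDP

end

noncomputable section
open scoped Classical ComplexOrder InnerProductSpace
open Filter Topology
namespace CDP

lemma exists_gns {A : Type} [CStarAlgebra A] [PartialOrder A] [StarOrderedRing A] (t : A →ₗ[ℂ] ℂ)
    (ht : ∀ x y, t (x * y) = t (y * x))
    (hp : ∀ x, 0 ≤ (t (star x * x)).re ∧ (t (star x * x)).im = 0) :
    ∃ (K : Type) (_ : NormedAddCommGroup K) (_ : InnerProductSpace ℂ K) (_ : CompleteSpace K)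
      (S : TrRep A K), S.t = t ∧ DenseRange S.Λ := by
  let f : A →ₚ[ℂ] ℂ := PositiveLinearMap.mk₀ t (by
    intro x hx
    obtain ⟨s, rfl⟩ := CStarAlgebra.nonneg_iff_eq_star_mul_self.mp hx
    exact Complex.nonneg_iff.mpr ⟨(hp s).1, (hp s).2.symm⟩)
  let S : TrRep A f.GNS :=
    { Λ := (UniformSpace.Completion.toComplₗᵢ (𝕜 := ℂ) (E := f.PreGNS)).toLinearMap.comp f.toPreGNS.toLinearMap
      t := t
      inner_eq := fun x y => by
        change inner ℂ ((f.toPreGNS x : f.PreGNS) : f.GNS) ((f.toPreGNS y : f.PreGNS) : f.GNS) = _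
        rw [UniformSpace.Completion.inner_coe, f.preGNS_inner_def]
        rfl
      tr := ht }
  refine ⟨f.GNS, inferInstance, inferInstance, inferInstance, S, rfl, ?_⟩
  exact UniformSpace.Completion.denseRange_coe.comp f.toPreGNS.surjective.denseRange
    (UniformSpace.Completion.continuous_coe _)

section I
variable {H : Type} [NormedAddCommGroup H] [InnerProductSpace ℂ H] [CompleteSpace H]

instance vn_closed (R : VonNeumannAlgebra H) : IsClosed (R.toStarSubalgebra : Set (H →L[ℂ] H)) := by
  have : (R.toStarSubalgebra : Set (H →L[ℂ] H)) = Set.centralizer (Set.centralizer (R : Set (H →L[ℂ] H))) := by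
    rw [R.centralizer_centralizer]; rfl
  rw [this]
  exact Set.isClosed_centralizer _

lemma wot_limit (x : ℕ → (H →L[ℂ] H)) (C : ℝ) (hC : ∀ n, ‖x n‖ ≤ C) :
    ∃ y : H →L[ℂ] H, ‖y‖ ≤ C ∧ ∀ ξ η : H,
      Tendsto (fun n => inner ℂ ξ (x n η)) (hyperfilter ℕ) (𝓝 (inner ℂ ξ (y η))) := by
  have hC0 : 0 ≤ C := (norm_nonneg _).trans (hC 0)
  have hb : ∀ n ξ η, ‖(inner ℂ ξ (x n η) : ℂ)‖ ≤ C * ‖ξ‖ * ‖η‖ := fun n ξ η => by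
    calc _ ≤ ‖ξ‖ * ‖x n η‖ := norm_inner_le_norm _ _
      _ ≤ ‖ξ‖ * (C * ‖η‖) := by gcongr; exact (x n).le_of_opNorm_le (hC n) η
      _ = _ := by ring
  have hex : ∀ ξ η : H, ∃ l : ℂ, ‖l‖ ≤ C * ‖ξ‖ * ‖η‖ ∧
      Tendsto (fun n => (inner ℂ ξ (x n η) : ℂ)) (hyperfilter ℕ) (𝓝 l) := by
    intro ξ η
    obtain ⟨l, hl, hlt⟩ := (isCompact_closedBall (0 : ℂ) (C * ‖ξ‖ * ‖η‖)).ultrafilter_le_nhds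
      ((hyperfilter ℕ).map (fun n => (inner ℂ ξ (x n η) : ℂ))) (by
        rw [le_principal_iff, Ultrafilter.coe_map, Filter.mem_map]
        exact Filter.univ_mem' fun n => mem_closedBall_zero_iff.mpr (hb n ξ η))
    exact ⟨l, mem_closedBall_zero_iff.mp hl, hlt⟩
  choose g hgb hg using hex
  let B₀ : H →ₗ⋆[ℂ] H →ₗ[ℂ] ℂ := LinearMap.mk₂'ₛₗ (starRingEnd ℂ) (RingHom.id ℂ) g
    (fun a b c => tendsto_nhds_unique (hg _ _) (((hg a c).add (hg b c)).congr fun n => by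
      rw [inner_add_left]))
    (fun a b c => tendsto_nhds_unique (hg _ _) (((hg b c).const_mul (starRingEnd ℂ a)).congr fun n => by
      rw [inner_smul_left]))
    (fun a b c => tendsto_nhds_unique (hg _ _) (((hg a b).add (hg a c)).congr fun n => by
      rw [map_add, inner_add_right]))
    (fun a b c => tendsto_nhds_unique (hg _ _) (((hg b c).const_mul a).congr fun n => by
      rw [map_smul, inner_smul_right]))
  let B : H →L⋆[ℂ] H →L[ℂ] ℂ := LinearMap.mkContinuous₂ B₀ C hgb
  let z := InnerProductSpace.continuousLinearMapOfBilin B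
  have hz : ∀ ξ η, inner ℂ ξ (star z η) = g ξ η := by
    intro ξ η
    rw [ContinuousLinearMap.star_eq_adjoint, ContinuousLinearMap.adjoint_inner_right]
    exact InnerProductSpace.continuousLinearMapOfBilin_apply B ξ η
  refine ⟨star z, ?_, fun ξ η => by rw [hz]; exact hg ξ η⟩
  refine ContinuousLinearMap.opNorm_le_bound _ hC0 fun η => ?_
  have h1 := hgb (star z η) η
  rw [← hz, inner_self_eq_norm_sq_to_K] at h1
  simp only [norm_pow, RCLike.norm_ofReal, abs_norm] at h1
  by_contra hn
  push Not at hn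
  have h2 : 0 < ‖star z η‖ := lt_of_le_of_lt (by positivity) hn
  nlinarith

lemma vn_wot (R : VonNeumannAlgebra H) (x : ℕ → (H →L[ℂ] H)) (hx : ∀ n, x n ∈ R) (y : H →L[ℂ] H)
    (hy : ∀ ξ η : H, Tendsto (fun n => inner ℂ ξ (x n η)) (hyperfilter ℕ) (𝓝 (inner ℂ ξ (y η)))) :
    y ∈ R := by
  rw [← SetLike.mem_coe, ← R.centralizer_centralizer]
  intro c hc
  refine ContinuousLinearMap.ext fun η => ext_inner_left ℂ fun ξ => ?_
  have h1 := hy (star c ξ) η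
  have h2 := hy ξ (c η)
  have hadj : ∀ ζ, inner ℂ (star c ξ) ζ = inner ℂ ξ (c ζ) := fun ζ => by
    rw [ContinuousLinearMap.star_eq_adjoint, ContinuousLinearMap.adjoint_inner_left]
  have h3 := tendsto_nhds_unique (h1.congr fun n => ?_) h2
  · rw [hadj] at h3
    exact h3
  · rw [hadj]
    have := hc (x n) (hx n)
    exact congrArg (fun f : H →L[ℂ] H => inner ℂ ξ (f η)) this.symm

lemma vn_ideal (R : VonNeumannAlgebra H)
    (hfac : ∀ x ∈ R, (∀ y ∈ R, x * y = y * x) → ∃ c : ℂ, x = c • (1 : H →L[ℂ] H))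
    (j : H →L[ℂ] H) (hjR : j ∈ R) (hj : j ≠ 0) (ξ : H) :
    ξ ∈ closure (Submodule.span ℂ {η : H | ∃ a ∈ R, ∃ ζ, η = (a * j) ζ} : Set H) := by
  set E₀ := Submodule.span ℂ {η : H | ∃ a ∈ R, ∃ ζ, η = (a * j) ζ} with hE₀
  let E := E₀.topologicalClosure
  have hEc : IsClosed (E : Set H) := E₀.isClosed_topologicalClosure
  have : CompleteSpace E := hEc.completeSpace_coe
  have hinv : ∀ y : H →L[ℂ] H, (∀ v ∈ {η : H | ∃ a ∈ R, ∃ ζ, η = (a * j) ζ}, y v ∈ E₀) →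
      E ∈ Module.End.invtSubmodule (y : H →ₗ[ℂ] H) := by
    intro y hy
    have h0 : E₀ ≤ E₀.comap (y : H →ₗ[ℂ] H) := Submodule.span_le.mpr hy
    intro v hv
    have : Set.MapsTo y (E₀ : Set H) (E₀ : Set H) := fun v hv => h0 hv
    exact this.closure y.continuous hv
  have hP : IsStarProjection E.starProjection := isStarProjection_starProjection
  have hr : E.starProjection.range = E := Submodule.range_starProjection E
  have hPR : E.starProjection ∈ R := by
    rw [VonNeumannAlgebra.IsStarProjection.mem_iff hP]
    intro y hy
    rw [hr]
    refine hinv y ?_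
    rintro _ ⟨a, ha, ζ, rfl⟩
    refine Submodule.subset_span ⟨a, ha, y ζ, ?_⟩
    have h1 := VonNeumannAlgebra.mem_commutant_iff.mp hy (a * j) (mul_mem ha hjR)
    exact congrArg (fun f : H →L[ℂ] H => f ζ) h1.symm
  have hPR' : E.starProjection ∈ R.commutant := by
    rw [VonNeumannAlgebra.IsStarProjection.mem_iff hP]
    intro y hy
    rw [VonNeumannAlgebra.commutant_commutant] at hy
    rw [hr]
    refine hinv y ?_
    rintro _ ⟨a, ha, ζ, rfl⟩
    exact Submodule.subset_span ⟨y * a, mul_mem hy ha, ζ, rfl⟩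
  obtain ⟨c, hc⟩ := hfac _ hPR fun y hy => (VonNeumannAlgebra.mem_commutant_iff.mp hPR' y hy).symm
  obtain ⟨ζ, hζ⟩ : ∃ ζ, j ζ ≠ 0 := by
    by_contra hn
    push Not at hn
    exact hj (ContinuousLinearMap.ext hn)
  have hm : j ζ ∈ E := subset_closure (Submodule.subset_span ⟨1, one_mem R, ζ, by simp⟩)
  have h1 : E.starProjection (j ζ) = j ζ := Submodule.starProjection_eq_self_iff.mpr hm
  have h2 : c = 1 := by
    rw [hc] at h1
    have : (c - 1) • j ζ = 0 := by
      rw [sub_smul, one_smul, sub_eq_zero]; exact h1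
    exact sub_eq_zero.mp ((smul_eq_zero.mp this).resolve_right hζ)
  have h3 : E.starProjection ξ = ξ := by rw [hc, h2]; simp
  exact Submodule.starProjection_eq_self_iff.mp h3

def mkVN (R : VonNeumannAlgebra H) [PartialOrder R.toStarSubalgebra] [StarOrderedRing R.toStarSubalgebra]
    (hfac : ∀ x ∈ R, (∀ y ∈ R, x * y = y * x) → ∃ c : ℂ, x = c • (1 : H →L[ℂ] H)) :
    VN R.toStarSubalgebra H where
  π := R.toStarSubalgebra.subtype
  norm_π := fun _ => rfl
  nonneg := fun x hx => by
    have h0 : (0 : H →L[ℂ] H) ≤ x := by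
      rw [ContinuousLinearMap.nonneg_iff_isPositive, ContinuousLinearMap.isPositive_iff_complex]
      intro ξ
      have := hx ξ
      rw [Complex.nonneg_iff] at this
      have e : inner ℂ ((x : H →L[ℂ] H) ξ) ξ = starRingEnd ℂ (inner ℂ ξ ((x : H →L[ℂ] H) ξ)) := by
        rw [inner_conj_symm]
      have h1 : (inner ℂ ξ ((x : H →L[ℂ] H) ξ) : ℂ).re ≥ 0 := this.1
      have h2 : (inner ℂ ξ ((x : H →L[ℂ] H) ξ) : ℂ).im = 0 := this.2.symm
      rw [e]
      generalize (inner ℂ ξ ((x : H →L[ℂ] H) ξ) : ℂ) = w at h1 h2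
      refine ⟨?_, by simpa using h1⟩
      apply Complex.ext <;> simp [h2]
    rw [StarOrderedRing.nonneg_iff_spectrum_nonneg (R := ℝ) x (by
      have := IsSelfAdjoint.of_nonneg h0
      exact Subtype.ext this)]
    intro l hl
    have := (StarOrderedRing.nonneg_iff_spectrum_nonneg (R := ℝ) (x : H →L[ℂ] H) (IsSelfAdjoint.of_nonneg h0)).mp h0
    refine this l ?_
    rw [← spectrum.algebraMap_mem_iff ℂ] at hl ⊢
    rwa [← StarSubalgebra.spectrum_eq]
  wot := fun x C hC => by
    obtain ⟨y, hy, hyt⟩ := wot_limit (fun n => (x n : H →L[ℂ] H)) C hC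
    exact ⟨⟨y, vn_wot R _ (fun n => (x n).2) y hyt⟩, hy, hyt⟩
  factor := fun x hx => by
    obtain ⟨c, hc⟩ := hfac x x.2 fun y hy => congrArg Subtype.val (hx ⟨y, hy⟩)
    exact ⟨c, Subtype.ext hc⟩
  ideal := fun j hj ξ => by
    have := vn_ideal R hfac j j.2 (fun h => hj (Subtype.ext h)) ξ
    convert this using 4
    ext η
    constructor
    · rintro ⟨a, ζ, rfl⟩
      exact ⟨a, a.2, ζ, rfl⟩
    · rintro ⟨a, ha, ζ, rfl⟩
      exact ⟨⟨a, ha⟩, ζ, rfl⟩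
end I
end CDP

end

noncomputable section
open scoped Classical ComplexOrder InnerProductSpace
open Filter Topology
namespace CDP

lemma reindex (ω : Ultrafilter ℕ) (hω : (ω : Filter ℕ) ≤ cofinite) (d : ℕ → ℕ → ℝ)
    (hd0 : ∀ n j, 0 ≤ d n j) (hd : ∀ j, Tendsto (fun n => d n j) ω (𝓝 0)) :
    ∃ k : ℕ → ℕ, Tendsto k ω atTop ∧ Tendsto (fun n => d n (k n)) ω (𝓝 0) := by
  let P : ℕ → ℕ → Prop := fun n m => ∀ j ≤ m, d n j ≤ 1 / ((m : ℝ) + 1)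
  let k : ℕ → ℕ := fun n => Nat.findGreatest (P n) n
  have key : ∀ M, ∀ᶠ n in (ω : Filter ℕ), M ≤ k n ∧ P n (k n) := by
    intro M
    have h1 : ∀ᶠ n in (ω : Filter ℕ), M ≤ n := by
      have : ∀ᶠ n in atTop, M ≤ n := eventually_ge_atTop M
      rw [← Nat.cofinite_eq_atTop] at this
      exact hω this
    have h2 : ∀ᶠ n in (ω : Filter ℕ), P n M := by
      have : ∀ j ∈ Finset.range (M + 1), ∀ᶠ n in (ω : Filter ℕ), d n j ≤ 1 / ((M : ℝ) + 1) := by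
        intro j _
        exact ((hd j).eventually (gt_mem_nhds (by positivity : (0 : ℝ) < 1 / ((M : ℝ) + 1)))).mono fun n h => h.le
      filter_upwards [(Filter.eventually_all_finset _).mpr this] with n hn j hj
      exact hn j (Finset.mem_range.mpr (by omega))
    filter_upwards [h1, h2] with n hn1 hn2
    exact ⟨Nat.le_findGreatest hn1 hn2, Nat.findGreatest_spec hn1 hn2⟩
  refine ⟨k, tendsto_atTop.mpr fun M => (key M).mono fun n h => h.1, ?_⟩
  rw [Metric.tendsto_nhds]
  intro ε hε
  obtain ⟨M, hM⟩ := exists_nat_one_div_lt hε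
  filter_upwards [key M] with n hn
  rw [Real.dist_eq, sub_zero, abs_of_nonneg (hd0 _ _)]
  refine (hn.2 _ le_rfl).trans_lt (lt_of_le_of_lt ?_ hM)
  have : (M : ℝ) ≤ k n := by exact_mod_cast hn.1
  gcongr

section J
variable {A K H : Type} [CStarAlgebra A] [PartialOrder A] [StarOrderedRing A]
  [NormedAddCommGroup K] [InnerProductSpace ℂ K] [CompleteSpace K]
  [NormedAddCommGroup H] [InnerProductSpace ℂ H] [CompleteSpace H]
  (S : TrRep A K) (V : VN A H)

lemma step1 (ω : Ultrafilter ℕ) (hω : (ω : Filter ℕ) ≤ cofinite) (θ : A → A) (Q : ℕ → Set A)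
    (hQ : ∀ n, Q n ⊆ Q (n + 1)) (hQd : ∀ x, ∀ ε : ℝ, 0 < ε → ∃ n, ∃ y ∈ Q n, ‖S.Λ (x - y)‖ ≤ ε)
    (u : ℕ → A) (huu : ∀ n, u n ∈ unitary A)
    (hu : ∀ r, Tendsto (fun n => ‖S.Λ (u n * r - r * u n)‖) ω (𝓝 0))
    (hc : ∀ y : ℕ → A, (∀ n, ‖y n‖ ≤ 1) →
      (∀ r, Tendsto (fun n => ‖S.Λ (y n * r - r * y n)‖) ω (𝓝 0)) →
      Tendsto (fun n => ‖S.Λ (θ (y n) - u n * y n * star (u n))‖) ω (𝓝 0))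
    (ε : ℝ) (hε : 0 < ε) :
    ∃ m, ∀ x : A, ‖x‖ ≤ 1 → (∀ y ∈ Q m, x * y = y * x) → ‖S.Λ (θ x - x)‖ ≤ ε := by
  by_contra hn
  push Not at hn
  choose x hx1 hxQ hxε using hn
  have hmono : Monotone Q := monotone_nat_of_le_succ hQ
  obtain ⟨k, hk, hkd⟩ := reindex ω hω (fun n j => ‖S.Λ (u n * x j - x j * u n)‖)
    (fun _ _ => norm_nonneg _) (fun j => hu (x j))
  have hcen : ∀ r, Tendsto (fun n => ‖S.Λ (x (k n) * r - r * x (k n))‖) ω (𝓝 0) := by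
    intro r
    rw [Metric.tendsto_nhds]
    intro e he
    obtain ⟨m, q, hq, hrq⟩ := hQd r (e / 4) (by positivity)
    filter_upwards [hk.eventually (eventually_ge_atTop m)] with n hn
    rw [Real.dist_eq, sub_zero, abs_of_nonneg (norm_nonneg _)]
    have h1 := hxQ (k n) q (hmono hn hq)
    have e1 : x (k n) * r - r * x (k n) = x (k n) * (r - q) - (r - q) * x (k n) := by
      rw [mul_sub, sub_mul, h1]; abel
    rw [e1, map_sub]
    have b1 := S.norm_mul_left (x (k n)) (r - q)
    have b2 := S.norm_mul_right (r - q) (x (k n))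
    have b3 := hx1 (k n)
    have b4 := norm_sub_le (S.Λ (x (k n) * (r - q))) (S.Λ ((r - q) * x (k n)))
    nlinarith [norm_nonneg (S.Λ (r - q)), norm_nonneg (x (k n))]
  have h1 := hc (fun n => x (k n)) (fun n => hx1 _) hcen
  have h2 := h1.add hkd
  rw [add_zero] at h2
  have h3 := h2.eventually (gt_mem_nhds hε)
  obtain ⟨n, hn⟩ := h3.exists
  have h4 := hxε (k n)
  set y := x (k n)
  have e2 : u n * y * star (u n) - y = (u n * y - y * u n) * star (u n) := by
    rw [sub_mul, mul_assoc y, Unitary.mul_star_self_of_mem (huu n), mul_one]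
  have e3 : ‖S.Λ (u n * y * star (u n) - y)‖ = ‖S.Λ (u n * y - y * u n)‖ := by
    rw [e2, S.norm_unitary_right (Unitary.star_mem (huu n))]
  have e4 : S.Λ (θ y - y) = S.Λ (θ y - u n * y * star (u n)) + S.Λ (u n * y * star (u n) - y) := by
    rw [← map_add]; congr 1; abel
  rw [e4] at h4
  have := norm_add_le (S.Λ (θ y - u n * y * star (u n))) (S.Λ (u n * y * star (u n) - y))
  rw [e3] at this
  linarith

theorem main_abs {A K H : Type} [CStarAlgebra A] [PartialOrder A] [StarOrderedRing A]
    [NormedAddCommGroup K] [InnerProductSpace ℂ K] [CompleteSpace K]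
    [NormedAddCommGroup H] [InnerProductSpace ℂ H] [CompleteSpace H]
    (S : TrRep A K) (V : VN A H) (h1 : ‖S.Λ 1‖ = 1) (hf : ∀ x, S.Λ x = 0 → x = 0) (hd : DenseRange S.Λ)
    (ω : Ultrafilter ℕ) (hω : (ω : Filter ℕ) ≤ cofinite) (θ : A →⋆ₐ[ℂ] A)
    (hθ : Function.Surjective θ) (N : ℕ → StarSubalgebra ℂ A) (hfd : ∀ n, FiniteDimensional ℂ (N n))
    (hQ : ∀ n, N n ≤ N (n + 1)) (hQd : ∀ x, ∀ ε : ℝ, 0 < ε → ∃ n, ∃ y ∈ N n, ‖S.Λ (x - y)‖ ≤ ε)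
    (u : ℕ → A) (huu : ∀ n, u n ∈ unitary A)
    (hu : ∀ r, Tendsto (fun n => ‖S.Λ (u n * r - r * u n)‖) ω (𝓝 0))
    (hc : ∀ y : ℕ → A, (∀ n, ‖y n‖ ≤ 1) →
      (∀ r, Tendsto (fun n => ‖S.Λ (y n * r - r * y n)‖) ω (𝓝 0)) →
      Tendsto (fun n => ‖S.Λ (θ (y n) - u n * y n * star (u n))‖) ω (𝓝 0)) :
    ∃ w ∈ unitary A, ∀ x, θ x = w * x * star w := by
  obtain ⟨S', hN, h1', hcmp⟩ := exists_normal S V h1 hf hd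
  have hL : 0 < ‖S'.Λ 1‖ := norm_pos_iff.mpr h1'
  obtain ⟨δ, hδ, hδc⟩ := hcmp (‖S'.Λ 1‖ / 2) (by positivity)
  obtain ⟨m, hm⟩ := step1 S ω hω θ (fun n => (N n : Set A)) (fun n => hQ n) hQd u huu hu hc δ hδ
  have hθu : ∀ v ∈ unitary A, θ v ∈ unitary A := fun v hv => by
    rw [Unitary.mem_iff] at hv ⊢
    rw [← map_star, ← map_mul, ← map_mul, hv.1, hv.2, map_one]; simp
  have hnu : ∀ v ∈ unitary A, ‖v‖ ≤ 1 := fun v hv => by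
    have := CStarRing.norm_star_mul_self (x := v)
    rw [Unitary.star_mul_self_of_mem hv] at this
    have := norm_one_le_one A
    nlinarith [norm_nonneg v]
  have := hfd m
  refine inner_of_close S' V hN h1' θ hθ (N m) fun v hv hvu => ?_
  refine hδc _ ?_ (hm v (hnu v hvu) hv)
  have a1 := hnu v hvu
  have a2 := hnu _ (hθu v hvu)
  have := norm_sub_le (θ v) v
  linarith
end J

open CD

section Fin
variable {Γ : Type} [Group Γ] {H : Type} [NormedAddCommGroup H] [InnerProductSpace ℂ H] [CompleteSpace H]
  (R : VonNeumannAlgebra H) (tr : TraceOn H (R : Set (H →L[ℂ] H)))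
  (act : ActionOn Γ H (R : Set (H →L[ℂ] H)) tr)

def actHom (γ : Γ) : R.toStarSubalgebra →⋆ₐ[ℂ] R.toStarSubalgebra :=
  have h1 : act.α γ 1 = 1 := by
    obtain ⟨x, hx, hx1⟩ := act.surj γ 1 (one_mem R)
    have := act.mulm γ 1 (one_mem R) x hx
    rw [one_mul, hx1, mul_one] at this
    exact this.symm
  { toFun := fun x => ⟨act.α γ x, act.mem γ x x.2⟩
    map_one' := Subtype.ext h1
    map_mul' := fun x y => Subtype.ext (act.mulm γ x x.2 y y.2)
    map_zero' := Subtype.ext (by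
      have := act.smulc γ 0 0 (zero_mem R)
      rw [zero_smul, zero_smul] at this
      exact this)
    map_add' := fun x y => Subtype.ext (act.add γ x x.2 y y.2)
    commutes' := fun c => Subtype.ext (by
      have := act.smulc γ c 1 (one_mem R)
      rw [h1] at this
      exact this)
    map_star' := fun x => Subtype.ext (act.star_map γ x x.2) }

lemma forward (hII1 : IsII1On tr (R : Set (H →L[ℂ] H)))
    (hAFD : IsAFD tr (R : Set (H →L[ℂ] H)))
    (ω : Ultrafilter ℕ) (hω : (ω : Filter ℕ) ≤ Filter.cofinite) (ho : act.IsOuter) :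
    act.IsCentrallyFree ω := by
  rintro γ hγ ⟨u, ⟨huR, ⟨C, huC⟩, huc⟩, huu, hx⟩
  apply ho γ hγ
  let _ : PartialOrder R.toStarSubalgebra := CStarAlgebra.spectralOrder R.toStarSubalgebra
  have _ : StarOrderedRing R.toStarSubalgebra := CStarAlgebra.spectralOrderedRing R.toStarSubalgebra
  let V := mkVN R hII1.1
  obtain ⟨K, _, _, _, S, hSt, hdense⟩ := exists_gns (A := R.toStarSubalgebra)
    (tr.τ.comp R.toStarSubalgebra.subtype.toAlgHom.toLinearMap)
    (fun x y => tr.tracial x x.2 y y.2) (fun x => tr.nonneg x x.2)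
  have hnorm : ∀ x : R.toStarSubalgebra, ‖S.Λ x‖ = tr.norm2 x := by
    intro x
    rw [TraceOn.norm2, ← Real.sqrt_sq (norm_nonneg (S.Λ x)), S.norm_sq, hSt]
    rfl
  have hone : ‖S.Λ 1‖ = 1 := by
    rw [hnorm, TraceOn.norm2]
    simp [tr.unital]
  have hf : ∀ x, S.Λ x = 0 → x = 0 := by
    intro x hx
    have h := S.inner_eq x x
    rw [hx, inner_zero_left, hSt] at h
    exact Subtype.ext (tr.faithful x x.2 h.symm)
  obtain ⟨Q, hQR, hQm, hQf, hQs, hQd⟩ := hAFD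
  let N : ℕ → StarSubalgebra ℂ R.toStarSubalgebra := fun n =>
    { carrier := {x | (x : H →L[ℂ] H) ∈ Q n}
      mul_mem' := fun {a b} ha hb => (hQs n).2.2.1 a ha b hb
      add_mem' := fun {a b} ha hb => (hQs n).2.1 a ha b hb
      algebraMap_mem' := fun c => (hQs n).2.2.2.1 c 1 (hQs n).1
      star_mem' := fun {a} ha => (hQs n).2.2.2.2 a ha }
  have hfd : ∀ n, FiniteDimensional ℂ (N n) := by
    intro n
    obtain ⟨k, v, hv, hs⟩ := hQf n
    let v' : Fin k → R.toStarSubalgebra := fun i => ⟨v i, hQR n (hv i)⟩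
    have : FiniteDimensional ℂ (Submodule.span ℂ (Set.range v')) :=
      FiniteDimensional.span_of_finite ℂ (Set.finite_range v')
    have hle : Subalgebra.toSubmodule (N n).toSubalgebra ≤ Submodule.span ℂ (Set.range v') := by
      intro x hx
      obtain ⟨c, hc⟩ := hs x hx
      have : x = ∑ i, c i • v' i := Subtype.ext (by rw [hc]; push_cast; rfl)
      rw [this]
      exact Submodule.sum_mem _ fun i _ => Submodule.smul_mem _ _ (Submodule.subset_span ⟨i, rfl⟩)
    exact Submodule.finiteDimensional_of_le hle
  obtain ⟨w, hw, hwx⟩ := main_abs S V hone hf hdense ω hω (actHom R tr act γ) (by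
      rintro ⟨y, hy⟩
      obtain ⟨x, hx, hxy⟩ := act.surj γ y hy
      exact ⟨⟨x, hx⟩, Subtype.ext hxy⟩) N hfd (fun n x hx => hQm n hx) (by
      intro x ε hε
      obtain ⟨n, y, hy, hxy⟩ := hQd x x.2 ε hε
      refine ⟨n, ⟨y, hQR n hy⟩, hy, ?_⟩
      rw [hnorm]; exact hxy)
    (fun n => ⟨u n, huR n⟩) (fun n => by
      rw [Unitary.mem_iff]
      exact ⟨Subtype.ext (huu n).2.1, Subtype.ext (huu n).2.2⟩) (by
      intro r
      simp only [hnorm]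
      exact huc r r.2) (by
      intro y hy hyc
      simp only [hnorm] at hyc ⊢
      exact hx (fun n => y n) ⟨fun n => (y n).2, ⟨1, hy⟩, fun r hr => hyc ⟨r, hr⟩⟩)
  refine ⟨w, ⟨w.2, ?_, ?_⟩, fun x hx => congrArg Subtype.val (hwx ⟨x, hx⟩)⟩
  · exact congrArg Subtype.val (Unitary.mem_iff.mp hw).1
  · exact congrArg Subtype.val (Unitary.mem_iff.mp hw).2

lemma backward (ω : Ultrafilter ℕ) (hcf : act.IsCentrallyFree ω) : act.IsOuter := by
  rintro γ hγ ⟨w, ⟨hwR, hw1, hw2⟩, hw⟩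
  have hn0 : tr.norm2 0 = 0 := by simp [TraceOn.norm2]
  refine hcf γ hγ ⟨fun _ => 1, ⟨fun _ => one_mem R, ⟨‖(1 : H →L[ℂ] H)‖, fun _ => le_rfl⟩, fun r hr => ?_⟩,
    fun _ => ⟨one_mem R, by simp, by simp⟩, fun x hx => ?_⟩
  · simp [hn0]
  · have h1 := hx.2.2 w hwR
    unfold UltraEq
    refine h1.congr fun n => ?_
    have hxR : x n ∈ R := hx.1 n
    have hs : star w ∈ R := star_mem hwR
    simp only [one_mul, star_one, mul_one]
    rw [hw _ (hx.1 n), TraceOn.norm2, TraceOn.norm2]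
    congr 2
    set z := x n * w - w * x n with hz
    have hzR : z ∈ R := sub_mem (mul_mem hxR hwR) (mul_mem hwR hxR)
    have e : w * x n * star w - x n = - (z * star w) := by
      rw [hz, sub_mul, mul_assoc (x n), hw2, mul_one, neg_sub]
    rw [e, star_neg, neg_mul_neg, star_mul, star_star]
    have h2 := tr.tracial (w * star z) (mul_mem hwR (star_mem hzR)) (z * star w) (mul_mem hzR hs)
    rw [h2]
    have h3 := tr.tracial z hzR (star z) (star_mem hzR)
    rw [← h3]
    congr 1
    rw [mul_assoc, ← mul_assoc (star w), hw1, one_mul]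
end Fin
end CDP

end

open CD in
/-- Let `R` be the hyperfinite II₁ factor (a II₁ factor which is
approximately finite dimensional), `ω` a free ultrafilter on `ℕ`, and `Γ` a countable
group acting on `R` by trace-preserving automorphisms. Then `Γ ↷ R` is outer if and
only if it is centrally free, i.e. the induced action on the central sequence algebra
`R' ∩ R^ω` is outer. -/
theorem stmt13_outer_iff_centrally_free_on_hyperfinite
    (Γ : Type) [Group Γ] [Countable Γ]
    (H : Type) [NormedAddCommGroup H] [InnerProductSpace ℂ H] [CompleteSpace H]
    -- the hyperfinite II₁ factor `R`
    (R : VonNeumannAlgebra H) (tr : TraceOn H (R : Set (H →L[ℂ] H)))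
    (hII1 : IsII1On tr (R : Set (H →L[ℂ] H)))
    (hAFD : IsAFD tr (R : Set (H →L[ℂ] H)))
    -- a free ultrafilter `ω` on `ℕ`
    (ω : Ultrafilter ℕ) (hω : (ω : Filter ℕ) ≤ Filter.cofinite)
    -- a trace-preserving action `Γ ↷ R`
    (act : ActionOn Γ H (R : Set (H →L[ℂ] H)) tr) :
    act.IsOuter ↔ act.IsCentrallyFree ω := by
  exact ⟨CDP.forward R tr act hII1 hAFD ω hω, CDP.backward R tr act ω⟩
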